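/- arXiv:1504.00520 — 5 statements merged into one kernel-verified Lean document; each statement's English description precedes it below -/
import Mathlib

section
/- Let s ∈ (0,∞) and r ∈ [1,∞] with 1 ≤ 1/s + 1/r, and let p be defined by 1/p = 1/s + 1/r. The class L_{HN(s,r)} of hyper-(s,r)-nuclear multilinear operators, endowed with the hyper-(s,r)-nuclear norm ‖·‖_{HN(s,r)}, is a p-Banach hyper-ideal: each component is a linear subspace containing the finite type operators; ‖·‖_{HN(s,r)} is a complete p-norm on each component; ‖I_n‖_{HN(s,r)} = 1 for every n, where I_n : 𝕂^n → 𝕂 is I_n(λ1,…,λn) = λ1⋯λn; and for all naturals 1 ≤ m1 < ⋯ < mn, continuous multilinear B1 ∈ L(G1,…,G_{m1};E1), …, Bn ∈ L(G_{m_{n-1}+1},…,G_{mn};En), A ∈ L_{HN(s,r)}(E1,…,En;F) and continuous linear t ∈ L(F;H0), the operator t∘A∘(B1,…,Bn) is hyper-(s,r)-nuclear with ‖t∘A∘(B1,…,Bn)‖_{HN(s,r)} ≤ ‖t‖·‖A‖_{HN(s,r)}·‖B1‖⋯‖Bn‖. -/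
open Filter Topology
open scoped ENNReal NNReal BigOperators

noncomputable section

/-- The type of classes of continuous multilinear operators between Banach spaces:
one set of continuous `n`-linear operators for each `n` and each tuple of Banach spaces
`E₁, …, Eₙ, F` over `𝕜`. -/
abbrev MultiClass (𝕜 : Type) [RCLike 𝕜] : Type 1 :=
  ∀ (n : ℕ) (E : Fin n → Type) [∀ i, NormedAddCommGroup (E i)] [∀ i, NormedSpace 𝕜 (E i)]
    [∀ i, CompleteSpace (E i)]
    (F : Type) [NormedAddCommGroup F] [NormedSpace 𝕜 F] [CompleteSpace F],
    Set (ContinuousMultilinearMap 𝕜 E F)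

/-- A real-valued "norm" function defined on all continuous multilinear operators
between Banach spaces. -/
abbrev MultiNorm (𝕜 : Type) [RCLike 𝕜] : Type 1 :=
  ∀ (n : ℕ) (E : Fin n → Type) [∀ i, NormedAddCommGroup (E i)] [∀ i, NormedSpace 𝕜 (E i)]
    [∀ i, CompleteSpace (E i)]
    (F : Type) [NormedAddCommGroup F] [NormedSpace 𝕜 F] [CompleteSpace F],
    ContinuousMultilinearMap 𝕜 E F → ℝ

variable (𝕜 : Type) [RCLike 𝕜]

/-- The finite type multilinear operators: the linear span of the operators
`(x₁,…,xₙ) ↦ φ₁(x₁)⋯φₙ(xₙ) • y` with `φᵢ ∈ Eᵢ'`, `y ∈ F`. -/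
def IsFiniteType {n : ℕ} {E : Fin n → Type} [∀ i, NormedAddCommGroup (E i)]
    [∀ i, NormedSpace 𝕜 (E i)] {F : Type} [NormedAddCommGroup F] [NormedSpace 𝕜 F]
    (A : ContinuousMultilinearMap 𝕜 E F) : Prop :=
  A ∈ Submodule.span 𝕜 {B : ContinuousMultilinearMap 𝕜 E F |
      ∃ (φ : ∀ i, E i →L[𝕜] 𝕜) (y : F), ∀ x, B x = (∏ i, φ i (x i)) • y}

/-- A multilinear operator has finite rank if its range spans a finite-dimensional
subspace of the target space. -/
def IsFiniteRank {n : ℕ} {E : Fin n → Type} [∀ i, NormedAddCommGroup (E i)]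
    [∀ i, NormedSpace 𝕜 (E i)] {F : Type} [NormedAddCommGroup F] [NormedSpace 𝕜 F]
    (A : ContinuousMultilinearMap 𝕜 E F) : Prop :=
  FiniteDimensional 𝕜 (Submodule.span 𝕜 (Set.range (⇑A)))

/-- `IsBlockComp 𝕜 f B A t C` says that `C = t ∘ A ∘ (B₁,…,Bₙ)`, where the blocks of
variables `(G₁,…,G_{m₁}), (G_{m₁+1},…,G_{m₂}), …` are the fibers of the monotone
surjection `f : Fin M → Fin n` (this encodes naturals `1 ≤ m₁ < ⋯ < mₙ = M`). -/
def IsBlockComp {n M : ℕ} {G : Fin M → Type} [∀ j, NormedAddCommGroup (G j)]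
    [∀ j, NormedSpace 𝕜 (G j)] {E : Fin n → Type} [∀ i, NormedAddCommGroup (E i)]
    [∀ i, NormedSpace 𝕜 (E i)] {F H0 : Type} [NormedAddCommGroup F] [NormedSpace 𝕜 F]
    [NormedAddCommGroup H0] [NormedSpace 𝕜 H0]
    (f : Fin M → Fin n)
    (B : ∀ i : Fin n, ContinuousMultilinearMap 𝕜 (fun j : {j : Fin M // f j = i} => G j.1) (E i))
    (A : ContinuousMultilinearMap 𝕜 E F) (t : F →L[𝕜] H0)
    (C : ContinuousMultilinearMap 𝕜 G H0) : Prop :=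
  ∀ x : ∀ j, G j, C x = t (A fun i => B i fun j => x j.1)

/-- All the hyper-ideal axioms except for the containment of the finite type operators:
each component is a linear subspace, and the class enjoys the hyper-ideal property. -/
structure IsHyperIdealCore (H : MultiClass 𝕜) : Prop where
  zero_mem : ∀ (n : ℕ) (E : Fin n → Type) [∀ i, NormedAddCommGroup (E i)]
      [∀ i, NormedSpace 𝕜 (E i)] [∀ i, CompleteSpace (E i)]
      (F : Type) [NormedAddCommGroup F] [NormedSpace 𝕜 F] [CompleteSpace F],
      (0 : ContinuousMultilinearMap 𝕜 E F) ∈ H n E F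
  add_mem : ∀ (n : ℕ) (E : Fin n → Type) [∀ i, NormedAddCommGroup (E i)]
      [∀ i, NormedSpace 𝕜 (E i)] [∀ i, CompleteSpace (E i)]
      (F : Type) [NormedAddCommGroup F] [NormedSpace 𝕜 F] [CompleteSpace F]
      {A B : ContinuousMultilinearMap 𝕜 E F},
      A ∈ H n E F → B ∈ H n E F → A + B ∈ H n E F
  smul_mem : ∀ (n : ℕ) (E : Fin n → Type) [∀ i, NormedAddCommGroup (E i)]
      [∀ i, NormedSpace 𝕜 (E i)] [∀ i, CompleteSpace (E i)]
      (F : Type) [NormedAddCommGroup F] [NormedSpace 𝕜 F] [CompleteSpace F]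
      (c : 𝕜) {A : ContinuousMultilinearMap 𝕜 E F},
      A ∈ H n E F → c • A ∈ H n E F
  comp_mem : ∀ (n M : ℕ) (G : Fin M → Type) [∀ j, NormedAddCommGroup (G j)]
      [∀ j, NormedSpace 𝕜 (G j)] [∀ j, CompleteSpace (G j)]
      (E : Fin n → Type) [∀ i, NormedAddCommGroup (E i)] [∀ i, NormedSpace 𝕜 (E i)]
      [∀ i, CompleteSpace (E i)]
      (F H0 : Type) [NormedAddCommGroup F] [NormedSpace 𝕜 F] [CompleteSpace F]
      [NormedAddCommGroup H0] [NormedSpace 𝕜 H0] [CompleteSpace H0]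
      (f : Fin M → Fin n), Monotone f → Function.Surjective f →
      ∀ (B : ∀ i : Fin n, ContinuousMultilinearMap 𝕜 (fun j : {j : Fin M // f j = i} => G j.1) (E i))
        (A : ContinuousMultilinearMap 𝕜 E F), A ∈ H n E F →
      ∀ (t : F →L[𝕜] H0) (C : ContinuousMultilinearMap 𝕜 G H0),
        IsBlockComp 𝕜 f B A t C → C ∈ H M G H0

/-- A hyper-ideal of multilinear operators. -/
structure IsHyperIdeal (H : MultiClass 𝕜) extends IsHyperIdealCore 𝕜 H : Prop where
  finiteType_mem : ∀ (n : ℕ) (E : Fin n → Type) [∀ i, NormedAddCommGroup (E i)]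
      [∀ i, NormedSpace 𝕜 (E i)] [∀ i, CompleteSpace (E i)]
      (F : Type) [NormedAddCommGroup F] [NormedSpace 𝕜 F] [CompleteSpace F]
      (A : ContinuousMultilinearMap 𝕜 E F), IsFiniteType 𝕜 A → A ∈ H n E F

/-- A `p`-normed hyper-ideal `(H, N)`. -/
structure IsPNormedHyperIdeal (H : MultiClass 𝕜) (N : MultiNorm 𝕜) (p : ℝ)
    extends IsHyperIdeal 𝕜 H : Prop where
  p_pos : 0 < p
  p_le_one : p ≤ 1
  norm_nonneg' : ∀ (n : ℕ) (E : Fin n → Type) [∀ i, NormedAddCommGroup (E i)]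
      [∀ i, NormedSpace 𝕜 (E i)] [∀ i, CompleteSpace (E i)]
      (F : Type) [NormedAddCommGroup F] [NormedSpace 𝕜 F] [CompleteSpace F]
      (A : ContinuousMultilinearMap 𝕜 E F), 0 ≤ N n E F A
  norm_eq_zero_iff : ∀ (n : ℕ) (E : Fin n → Type) [∀ i, NormedAddCommGroup (E i)]
      [∀ i, NormedSpace 𝕜 (E i)] [∀ i, CompleteSpace (E i)]
      (F : Type) [NormedAddCommGroup F] [NormedSpace 𝕜 F] [CompleteSpace F]
      {A : ContinuousMultilinearMap 𝕜 E F}, A ∈ H n E F → (N n E F A = 0 ↔ A = 0)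
  norm_smul : ∀ (n : ℕ) (E : Fin n → Type) [∀ i, NormedAddCommGroup (E i)]
      [∀ i, NormedSpace 𝕜 (E i)] [∀ i, CompleteSpace (E i)]
      (F : Type) [NormedAddCommGroup F] [NormedSpace 𝕜 F] [CompleteSpace F]
      (c : 𝕜) {A : ContinuousMultilinearMap 𝕜 E F}, A ∈ H n E F →
      N n E F (c • A) = ‖c‖ * N n E F A
  norm_add_le : ∀ (n : ℕ) (E : Fin n → Type) [∀ i, NormedAddCommGroup (E i)]
      [∀ i, NormedSpace 𝕜 (E i)] [∀ i, CompleteSpace (E i)]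
      (F : Type) [NormedAddCommGroup F] [NormedSpace 𝕜 F] [CompleteSpace F]
      {A B : ContinuousMultilinearMap 𝕜 E F}, A ∈ H n E F → B ∈ H n E F →
      N n E F (A + B) ^ p ≤ N n E F A ^ p + N n E F B ^ p
  norm_In : ∀ n : ℕ,
      N n (fun _ => 𝕜) 𝕜 (ContinuousMultilinearMap.mkPiAlgebra 𝕜 (Fin n) 𝕜) = 1
  norm_comp_le : ∀ (n M : ℕ) (G : Fin M → Type) [∀ j, NormedAddCommGroup (G j)]
      [∀ j, NormedSpace 𝕜 (G j)] [∀ j, CompleteSpace (G j)]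
      (E : Fin n → Type) [∀ i, NormedAddCommGroup (E i)] [∀ i, NormedSpace 𝕜 (E i)]
      [∀ i, CompleteSpace (E i)]
      (F H0 : Type) [NormedAddCommGroup F] [NormedSpace 𝕜 F] [CompleteSpace F]
      [NormedAddCommGroup H0] [NormedSpace 𝕜 H0] [CompleteSpace H0]
      (f : Fin M → Fin n), Monotone f → Function.Surjective f →
      ∀ (B : ∀ i : Fin n, ContinuousMultilinearMap 𝕜 (fun j : {j : Fin M // f j = i} => G j.1) (E i))
        (A : ContinuousMultilinearMap 𝕜 E F), A ∈ H n E F →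
      ∀ (t : F →L[𝕜] H0) (C : ContinuousMultilinearMap 𝕜 G H0),
        IsBlockComp 𝕜 f B A t C →
        N M G H0 C ≤ ‖t‖ * N n E F A * ∏ i, ‖B i‖

/-- A `p`-Banach hyper-ideal: a `p`-normed hyper-ideal each of whose components is
complete in the topology generated by the `p`-norm `N`. -/
structure IsPBanachHyperIdeal (H : MultiClass 𝕜) (N : MultiNorm 𝕜) (p : ℝ)
    extends IsPNormedHyperIdeal 𝕜 H N p : Prop where
  complete : ∀ (n : ℕ) (E : Fin n → Type) [∀ i, NormedAddCommGroup (E i)]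
      [∀ i, NormedSpace 𝕜 (E i)] [∀ i, CompleteSpace (E i)]
      (F : Type) [NormedAddCommGroup F] [NormedSpace 𝕜 F] [CompleteSpace F]
      (u : ℕ → ContinuousMultilinearMap 𝕜 E F), (∀ k, u k ∈ H n E F) →
      (∀ ε : ℝ, 0 < ε → ∃ K : ℕ, ∀ k ≥ K, ∀ l ≥ K, N n E F (u k - u l) < ε) →
      ∃ A ∈ H n E F, Tendsto (fun k => N n E F (u k - A)) atTop (𝓝 0)

/-- The uniform (operator) norm, as a `MultiNorm`. -/
def opMultiNorm : MultiNorm 𝕜 := by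
  intro n E _ _ _ F _ _ _
  exact fun A => ‖A‖

/-- `(λ_j)_j ∈ ℓ_s`. -/
def MemLs (s : ℝ) (lam : ℕ → 𝕜) : Prop := Summable fun j => ‖lam j‖ ^ s

/-- The `ℓ_s`-norm of a scalar sequence. -/
def lsNorm (s : ℝ) (lam : ℕ → 𝕜) : ℝ := (∑' j, ‖lam j‖ ^ s) ^ (1 / s)

/-- A bounded sequence. -/
def BddSeq {X : Type} [NormedAddCommGroup X] (T : ℕ → X) : Prop := ∃ c, ∀ j, ‖T j‖ ≤ c

/-- `(T_j)_j` is weakly `r`-summable in `X`; for `r = ∞` this means bounded. -/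
def WeaklySummable (r : ℝ≥0∞) {X : Type} [NormedAddCommGroup X] [NormedSpace 𝕜 X]
    (T : ℕ → X) : Prop :=
  if r = ⊤ then BddSeq T
  else ∀ φ : X →L[𝕜] 𝕜, Summable fun j => ‖φ (T j)‖ ^ r.toReal

/-- The `ℓ_r`-norm of a sequence of reals (`r = ∞` gives the sup). -/
def seqLrNorm (r : ℝ≥0∞) (a : ℕ → ℝ) : ℝ :=
  if r = ⊤ then ⨆ j, |a j| else (∑' j, |a j| ^ r.toReal) ^ (1 / r.toReal)

/-- The weak `ℓ_r`-norm `‖(T_j)_j‖_{w,r} = sup_{‖φ‖ ≤ 1} ‖(φ(T_j))_j‖_r`. -/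
def weakNorm (r : ℝ≥0∞) {X : Type} [NormedAddCommGroup X] [NormedSpace 𝕜 X]
    (T : ℕ → X) : ℝ :=
  ⨆ φ : {φ : X →L[𝕜] 𝕜 // ‖φ‖ ≤ 1}, seqLrNorm r fun j => ‖(φ : X →L[𝕜] 𝕜) (T j)‖

/-- `(lam, T, y)` is a hyper-`(s,r)`-nuclear representation of `A`, i.e. `lam ∈ ℓ_s`,
`T` is a weakly `r`-summable sequence of `n`-linear forms, `y` is a bounded sequence and
`A(x) = ∑_j lam_j T_j(x) • y_j`. -/
def IsHyperNuclearRep {n : ℕ} {E : Fin n → Type} [∀ i, NormedAddCommGroup (E i)]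
    [∀ i, NormedSpace 𝕜 (E i)] {F : Type} [NormedAddCommGroup F] [NormedSpace 𝕜 F]
    (s : ℝ) (r : ℝ≥0∞) (lam : ℕ → 𝕜) (T : ℕ → ContinuousMultilinearMap 𝕜 E 𝕜)
    (y : ℕ → F) (A : ContinuousMultilinearMap 𝕜 E F) : Prop :=
  MemLs 𝕜 s lam ∧ WeaklySummable 𝕜 r T ∧ BddSeq y ∧
    ∀ x, HasSum (fun j => (lam j * T j x) • y j) (A x)

/-- Hyper-`(s,r)`-nuclear multilinear operators (`s = 1`, `r = ∞` gives the
hyper-nuclear operators). -/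
def IsHyperNuclear {n : ℕ} {E : Fin n → Type} [∀ i, NormedAddCommGroup (E i)]
    [∀ i, NormedSpace 𝕜 (E i)] {F : Type} [NormedAddCommGroup F] [NormedSpace 𝕜 F]
    (s : ℝ) (r : ℝ≥0∞) (A : ContinuousMultilinearMap 𝕜 E F) : Prop :=
  ∃ lam T y, IsHyperNuclearRep 𝕜 s r lam T y A

/-- The hyper-`(s,r)`-nuclear norm. -/
def hnNorm {n : ℕ} {E : Fin n → Type} [∀ i, NormedAddCommGroup (E i)]
    [∀ i, NormedSpace 𝕜 (E i)] {F : Type} [NormedAddCommGroup F] [NormedSpace 𝕜 F]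
    (s : ℝ) (r : ℝ≥0∞) (A : ContinuousMultilinearMap 𝕜 E F) : ℝ :=
  sInf {c : ℝ | ∃ lam T y, IsHyperNuclearRep 𝕜 s r lam T y A ∧
    c = lsNorm 𝕜 s lam * weakNorm 𝕜 r T * ⨆ j, ‖y j‖}

/-- The hyper-`(s,r)`-nuclear operators, as a `MultiClass`. -/
def hnClass (s : ℝ) (r : ℝ≥0∞) : MultiClass 𝕜 := by
  intro n E _ _ _ F _ _ _
  exact {A | IsHyperNuclear 𝕜 s r A}

/-- The hyper-`(s,r)`-nuclear norm, as a `MultiNorm`. -/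
def hnMultiNorm (s : ℝ) (r : ℝ≥0∞) : MultiNorm 𝕜 := by
  intro n E _ _ _ F _ _ _
  exact fun A => hnNorm 𝕜 s r A

section SequenceBounds

variable {ι κ : Type*} {r : ℝ≥0∞}

/-- The family of nonnegative reals `b` has `ℓ_r`-norm at most `W`. -/
def LrBound (r : ℝ≥0∞) (b : ι → ℝ) (W : ℝ) : Prop :=
  if r = ⊤ then ∀ i, b i ≤ W else ∀ S : Finset ι, ∑ i ∈ S, b i ^ r.toReal ≤ W ^ r.toReal

lemma lrBound_top {b : ι → ℝ} {W : ℝ} : LrBound ⊤ b W ↔ ∀ i, b i ≤ W := by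
  simp [LrBound]

lemma lrBound_of_ne_top (hr : r ≠ ⊤) {b : ι → ℝ} {W : ℝ} :
    LrBound r b W ↔ ∀ S : Finset ι, ∑ i ∈ S, b i ^ r.toReal ≤ W ^ r.toReal := by
  simp [LrBound, hr]

lemma LrBound.le (hr : r ≠ 0) {b : ι → ℝ} {W : ℝ} (h : LrBound r b W) (hb : ∀ i, 0 ≤ b i)
    (hW : 0 ≤ W) (i : ι) : b i ≤ W := by
  by_cases hr' : r = ⊤
  · subst hr'
    exact lrBound_top.1 h i
  · have := (lrBound_of_ne_top hr').1 h {i}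
    rw [Finset.sum_singleton] at this
    exact (Real.rpow_le_rpow_iff (hb i) hW (ENNReal.toReal_pos hr hr')).1 this

lemma LrBound.mono_left {b b' : ι → ℝ} {W : ℝ} (h : LrBound r b W) (hb' : ∀ i, 0 ≤ b' i)
    (hle : ∀ i, b' i ≤ b i) : LrBound r b' W := by
  by_cases hr' : r = ⊤
  · subst hr'
    exact lrBound_top.2 fun i => (hle i).trans (lrBound_top.1 h i)
  · exact (lrBound_of_ne_top hr').2 fun S => (Finset.sum_le_sum fun i _ =>
      Real.rpow_le_rpow (hb' i) (hle i) ENNReal.toReal_nonneg).trans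
        ((lrBound_of_ne_top hr').1 h S)

lemma LrBound.const_mul {b : ι → ℝ} {W c : ℝ} (h : LrBound r b W) (hb : ∀ i, 0 ≤ b i)
    (hW : 0 ≤ W) (hc : 0 ≤ c) : LrBound r (fun i => c * b i) (c * W) := by
  by_cases hr' : r = ⊤
  · subst hr'
    exact lrBound_top.2 fun i => mul_le_mul_of_nonneg_left (lrBound_top.1 h i) hc
  · refine (lrBound_of_ne_top hr').2 fun S => ?_
    simp_rw [fun i => Real.mul_rpow (z := r.toReal) hc (hb i), Real.mul_rpow hc hW,
      ← Finset.mul_sum]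
    exact mul_le_mul_of_nonneg_left ((lrBound_of_ne_top hr').1 h S) (Real.rpow_nonneg hc _)

lemma LrBound.comp_injective {b : ι → ℝ} {W : ℝ} (h : LrBound r b W) {e : κ → ι}
    (he : Function.Injective e) : LrBound r (fun k => b (e k)) W := by
  by_cases hr' : r = ⊤
  · subst hr'
    exact lrBound_top.2 fun k => lrBound_top.1 h _
  · refine (lrBound_of_ne_top hr').2 fun S => ?_
    have := (lrBound_of_ne_top hr').1 h (S.map ⟨e, he⟩)
    simpa using this

lemma lrBound_zero (hr : r ≠ 0) {W : ℝ} (hW : 0 ≤ W) :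
    LrBound r (fun _ : ι => (0 : ℝ)) W := by
  by_cases hr' : r = ⊤
  · subst hr'
    exact lrBound_top.2 fun _ => hW
  · refine (lrBound_of_ne_top hr').2 fun S => ?_
    simp [Real.zero_rpow (ENNReal.toReal_pos hr hr').ne', Real.rpow_nonneg hW]

lemma lrBound_single [DecidableEq ι] (hr : r ≠ 0) (i₀ : ι) {w : ℝ} (hw : 0 ≤ w) :
    LrBound r (fun i => if i = i₀ then w else 0) w := by
  by_cases hr' : r = ⊤
  · subst hr'
    refine lrBound_top.2 fun i => ?_
    split_ifs <;> simp [hw]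
  · refine (lrBound_of_ne_top hr').2 fun S => ?_
    have h0 := Real.zero_rpow (ENNReal.toReal_pos hr hr').ne'
    simp only [apply_ite (fun x : ℝ => x ^ r.toReal), h0, Finset.sum_ite_eq']
    split_ifs
    exacts [le_rfl, Real.rpow_nonneg hw _]

lemma rpow_mul_inv_toReal (hr : r ≠ 0) (hr' : r ≠ ⊤) {a : ℝ} (ha : 0 ≤ a) (p : ℝ) :
    (a ^ (p * (r⁻¹).toReal)) ^ r.toReal = a ^ p := by
  rw [← Real.rpow_mul ha, ENNReal.toReal_inv, inv_mul_cancel_right₀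
    (ENNReal.toReal_pos hr hr').ne']

/-- Juxtaposition of families whose normalized `ℓ_r`-bounds are `p`-summable. -/
lemma LrBound.uncurry (hr : r ≠ 0) {b : κ → ι → ℝ} {a : κ → ℝ} {B p : ℝ}
    (ha : ∀ k, 0 ≤ a k) (hB : 0 ≤ B) (hb : ∀ k i, 0 ≤ b k i)
    (h : ∀ k, LrBound r (b k) (a k ^ (p * (r⁻¹).toReal)))
    (hsum : HasSum (fun k => a k ^ p) (B ^ p)) :
    LrBound r (fun x : κ × ι => b x.1 x.2) (B ^ (p * (r⁻¹).toReal)) := by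
  classical
  by_cases hr' : r = ⊤
  · subst hr'
    refine lrBound_top.2 fun x => ?_
    simpa using lrBound_top.1 (h x.1) x.2
  · refine (lrBound_of_ne_top hr').2 fun S => ?_
    rw [rpow_mul_inv_toReal hr hr' hB]
    calc ∑ x ∈ S, b x.1 x.2 ^ r.toReal
        ≤ ∑ x ∈ S.image Prod.fst ×ˢ S.image Prod.snd, b x.1 x.2 ^ r.toReal :=
          Finset.sum_le_sum_of_subset_of_nonneg Finset.subset_product
            fun x _ _ => Real.rpow_nonneg (hb _ _) _
      _ = ∑ k ∈ S.image Prod.fst, ∑ i ∈ S.image Prod.snd, b k i ^ r.toReal :=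
          Finset.sum_product _ _ _
      _ ≤ ∑ k ∈ S.image Prod.fst, a k ^ p := by
          refine Finset.sum_le_sum fun k _ => ?_
          rw [← rpow_mul_inv_toReal hr hr' (ha k)]
          exact (lrBound_of_ne_top hr').1 (h k) _
      _ ≤ B ^ p := sum_le_hasSum _ (fun k _ => Real.rpow_nonneg (ha k) _) hsum

lemma rpow_mul_eq_rpow_mul (hr : r ≠ 0) (hr' : r ≠ ⊤) {a : ℝ} (ha : 0 ≤ a) (p : ℝ) :
    (a ^ r.toReal) ^ (p * (r⁻¹).toReal) = a ^ p := by
  rw [← Real.rpow_mul ha, ENNReal.toReal_inv, mul_comm, inv_mul_cancel_right₀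
    (ENNReal.toReal_pos hr hr').ne']

/-- Hölder's inequality for exponents `1/q + 1/r ≥ 1`, for normalized families. -/
lemma LrBound.sum_mul_le_one {q : ℝ≥0∞} (hq : q ≠ 0) (hq' : q ≠ ⊤) (hr : r ≠ 0) {p : ℝ}
    (hp : 0 < p) (hp1 : p ≤ 1) (hpqr : p * (q⁻¹).toReal + p * (r⁻¹).toReal = 1)
    {a b : ι → ℝ} (ha : ∀ i, 0 ≤ a i) (hb : ∀ i, 0 ≤ b i)
    (hA : LrBound q a 1) (hB : LrBound r b 1) (S : Finset ι) :
    ∑ i ∈ S, a i * b i ≤ 1 := by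
  have ha1 := hA.le hq ha zero_le_one
  have hb1 := hB.le hr hb zero_le_one
  have hpow : ∀ i, a i * b i ≤ a i ^ p * b i ^ p := fun i => by
    rw [← Real.mul_rpow (ha i) (hb i)]
    exact Real.self_le_rpow_of_le_one (mul_nonneg (ha i) (hb i))
      (mul_le_one₀ (ha1 i) (hb i) (hb1 i)) hp1
  have hA' := (lrBound_of_ne_top hq').1 hA S
  rw [Real.one_rpow] at hA'
  by_cases hr' : r = ⊤
  · subst hr'
    simp only [ENNReal.inv_top, ENNReal.toReal_zero, mul_zero, add_zero] at hpqr
    have hpq : p = q.toReal := by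
      rw [ENNReal.toReal_inv] at hpqr
      field_simp [(ENNReal.toReal_pos hq hq').ne'] at hpqr
      exact hpqr
    refine le_trans (Finset.sum_le_sum fun i _ => ?_) hA'
    rw [← hpq]
    exact (hpow i).trans (mul_le_of_le_one_right (Real.rpow_nonneg (ha i) _)
      (Real.rpow_le_one (hb i) (hb1 i) hp.le))
  · have hB' := (lrBound_of_ne_top hr').1 hB S
    rw [Real.one_rpow] at hB'
    have hw₁ : 0 ≤ p * (q⁻¹).toReal := by positivity
    have hw₂ : 0 ≤ p * (r⁻¹).toReal := by positivity
    calc ∑ i ∈ S, a i * b i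
        ≤ ∑ i ∈ S, (p * (q⁻¹).toReal * a i ^ q.toReal + p * (r⁻¹).toReal * b i ^ r.toReal) := by
          refine Finset.sum_le_sum fun i _ => (hpow i).trans ?_
          rw [← rpow_mul_eq_rpow_mul hq hq' (ha i), ← rpow_mul_eq_rpow_mul hr hr' (hb i)]
          exact Real.geom_mean_le_arith_mean2_weighted hw₁ hw₂
            (Real.rpow_nonneg (ha i) _) (Real.rpow_nonneg (hb i) _) hpqr
      _ = p * (q⁻¹).toReal * ∑ i ∈ S, a i ^ q.toReal
            + p * (r⁻¹).toReal * ∑ i ∈ S, b i ^ r.toReal := by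
          rw [Finset.sum_add_distrib, Finset.mul_sum, Finset.mul_sum]
      _ ≤ p * (q⁻¹).toReal * 1 + p * (r⁻¹).toReal * 1 := by gcongr
      _ = 1 := by rw [mul_one, mul_one, hpqr]

/-- Hölder's inequality for exponents `1/q + 1/r ≥ 1`. -/
lemma LrBound.sum_mul_le {q : ℝ≥0∞} (hq : q ≠ 0) (hq' : q ≠ ⊤) (hr : r ≠ 0) {p : ℝ}
    (hp : 0 < p) (hp1 : p ≤ 1) (hpqr : p * (q⁻¹).toReal + p * (r⁻¹).toReal = 1)
    {a b : ι → ℝ} (ha : ∀ i, 0 ≤ a i) (hb : ∀ i, 0 ≤ b i) {L W : ℝ} (hL : 0 ≤ L) (hW : 0 ≤ W)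
    (hA : LrBound q a L) (hB : LrBound r b W) (S : Finset ι) :
    ∑ i ∈ S, a i * b i ≤ L * W := by
  rcases hL.eq_or_lt with rfl | hL'
  · have : ∀ i, a i = 0 := fun i => le_antisymm (hA.le hq ha le_rfl i) (ha i)
    simp [this]
  rcases hW.eq_or_lt with rfl | hW'
  · have : ∀ i, b i = 0 := fun i => le_antisymm (hB.le hr hb le_rfl i) (hb i)
    simp [this]
  have hA1 := hA.const_mul ha hL (inv_nonneg.2 hL)
  have hB1 := hB.const_mul hb hW (inv_nonneg.2 hW)
  rw [inv_mul_cancel₀ hL'.ne'] at hA1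
  rw [inv_mul_cancel₀ hW'.ne'] at hB1
  have key := LrBound.sum_mul_le_one hq hq' hr hp hp1 hpqr
    (fun i => mul_nonneg (inv_nonneg.2 hL) (ha i)) (fun i => mul_nonneg (inv_nonneg.2 hW) (hb i))
    hA1 hB1 S
  calc ∑ i ∈ S, a i * b i = L * W * ∑ i ∈ S, L⁻¹ * a i * (W⁻¹ * b i) := by
        rw [Finset.mul_sum]
        refine Finset.sum_congr rfl fun i _ => ?_
        field_simp
    _ ≤ L * W * 1 := by gcongr
    _ = L * W := mul_one _

end SequenceBounds

section WeakBounds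

variable {ι κ : Type*} {r : ℝ≥0∞}

lemma LrBound.summable (hr' : r ≠ ⊤) {b : ι → ℝ} {W : ℝ} (hb : ∀ i, 0 ≤ b i)
    (h : LrBound r b W) : Summable fun i => b i ^ r.toReal :=
  summable_of_sum_le (fun i => Real.rpow_nonneg (hb i) _) ((lrBound_of_ne_top hr').1 h)

lemma LrBound.tsum_rpow_le (hr : r ≠ 0) (hr' : r ≠ ⊤) {b : ι → ℝ} {W : ℝ}
    (hb : ∀ i, 0 ≤ b i) (hW : 0 ≤ W) (h : LrBound r b W) :
    (∑' i, b i ^ r.toReal) ^ (1 / r.toReal) ≤ W := by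
  rw [one_div, Real.rpow_inv_le_iff_of_pos (tsum_nonneg fun i => Real.rpow_nonneg (hb i) _) hW
    (ENNReal.toReal_pos hr hr')]
  exact (h.summable hr' hb).tsum_le_of_sum_le ((lrBound_of_ne_top hr').1 h)

lemma lrBound_of_summable (hr : r ≠ 0) (hr' : r ≠ ⊤) {b : ι → ℝ} (hb : ∀ i, 0 ≤ b i)
    (h : Summable fun i => b i ^ r.toReal) :
    LrBound r b ((∑' i, b i ^ r.toReal) ^ (1 / r.toReal)) := by
  refine (lrBound_of_ne_top hr').2 fun S => ?_
  rw [one_div, Real.rpow_inv_rpow (tsum_nonneg fun i => Real.rpow_nonneg (hb i) _)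
    (ENNReal.toReal_pos hr hr').ne']
  exact h.sum_le_tsum S fun i _ => Real.rpow_nonneg (hb i) _

lemma LrBound.mono_right {b : ι → ℝ} {W W' : ℝ} (h : LrBound r b W) (hW : 0 ≤ W)
    (hle : W ≤ W') : LrBound r b W' := by
  by_cases hr' : r = ⊤
  · subst hr'
    exact lrBound_top.2 fun i => (lrBound_top.1 h i).trans hle
  · exact (lrBound_of_ne_top hr').2 fun S => ((lrBound_of_ne_top hr').1 h S).trans
      (Real.rpow_le_rpow hW hle ENNReal.toReal_nonneg)

variable {𝕜} {s : ℝ}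

lemma lsNorm_nonneg (lam : ℕ → 𝕜) : 0 ≤ lsNorm 𝕜 s lam :=
  Real.rpow_nonneg (tsum_nonneg fun _ => Real.rpow_nonneg (norm_nonneg _) _) _

lemma MemLs.lrBound (hs : 0 < s) {lam : ℕ → 𝕜} (h : MemLs 𝕜 s lam) :
    LrBound (ENNReal.ofReal s) (fun j => ‖lam j‖) (lsNorm 𝕜 s lam) := by
  have := lrBound_of_summable (r := ENNReal.ofReal s) (ENNReal.ofReal_pos.2 hs).ne'
    ENNReal.ofReal_ne_top (b := fun j => ‖lam j‖) (fun j => norm_nonneg _)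
  rw [ENNReal.toReal_ofReal hs.le] at this
  exact this h

lemma LrBound.memLs (hs : 0 < s) {lam : ℕ → 𝕜} {L : ℝ}
    (h : LrBound (ENNReal.ofReal s) (fun j => ‖lam j‖) L) : MemLs 𝕜 s lam := by
  have := h.summable ENNReal.ofReal_ne_top fun j => norm_nonneg _
  rwa [ENNReal.toReal_ofReal hs.le] at this

lemma LrBound.lsNorm_le (hs : 0 < s) {lam : ℕ → 𝕜} {L : ℝ} (hL : 0 ≤ L)
    (h : LrBound (ENNReal.ofReal s) (fun j => ‖lam j‖) L) : lsNorm 𝕜 s lam ≤ L := by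
  have := h.tsum_rpow_le (ENNReal.ofReal_pos.2 hs).ne' ENNReal.ofReal_ne_top
    (fun j => norm_nonneg _) hL
  rwa [ENNReal.toReal_ofReal hs.le] at this

variable {X Y : Type} [NormedAddCommGroup X] [NormedSpace 𝕜 X] [NormedAddCommGroup Y]
  [NormedSpace 𝕜 Y]

variable (𝕜) in
/-- The family `T` has weak `ℓ_r`-norm at most `W`. -/
def WeakBound (r : ℝ≥0∞) (T : ι → X) (W : ℝ) : Prop :=
  ∀ φ : X →L[𝕜] 𝕜, ‖φ‖ ≤ 1 → LrBound r (fun i => ‖φ (T i)‖) W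

lemma WeakBound.lrBound_apply (hr : r ≠ 0) {T : ι → X} {W K : ℝ} (h : WeakBound 𝕜 r T W)
    (hW : 0 ≤ W) (φ : X →L[𝕜] 𝕜) (hφ : ‖φ‖ ≤ K) : LrBound r (fun i => ‖φ (T i)‖) (K * W) := by
  rcases ((norm_nonneg φ).trans hφ).eq_or_lt with rfl | hK
  · have : φ = 0 := norm_le_zero_iff.1 hφ
    simpa [this] using lrBound_zero hr le_rfl
  · have hK' : ‖((K⁻¹ : ℝ) : 𝕜)‖ = K⁻¹ := by
      rw [RCLike.norm_ofReal, abs_of_pos (inv_pos.2 hK)]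
    have h1 : ‖((K⁻¹ : ℝ) : 𝕜) • φ‖ ≤ 1 := by
      rw [norm_smul, hK', inv_mul_le_one₀ hK]
      exact hφ
    have := (h _ h1).const_mul (fun _ => norm_nonneg _) hW hK.le
    refine this.mono_left (fun _ => norm_nonneg _) fun i => le_of_eq ?_
    rw [smul_apply, norm_smul, hK', mul_inv_cancel_left₀ hK.ne']

lemma WeakBound.map (hr : r ≠ 0) {T : ι → X} {W K : ℝ} (h : WeakBound 𝕜 r T W)
    (hW : 0 ≤ W) (Φ : X →L[𝕜] Y) (hΦ : ‖Φ‖ ≤ K) :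
    WeakBound 𝕜 r (fun i => Φ (T i)) (K * W) := by
  intro φ hφ
  refine h.lrBound_apply hr hW (φ.comp Φ) ?_
  calc ‖φ.comp Φ‖ ≤ ‖φ‖ * ‖Φ‖ := φ.opNorm_comp_le Φ
    _ ≤ 1 * K := by gcongr
    _ = K := one_mul K

lemma WeakBound.const_smul (hr : r ≠ 0) {T : ι → X} {W : ℝ} (h : WeakBound 𝕜 r T W)
    (hW : 0 ≤ W) (c : 𝕜) : WeakBound 𝕜 r (fun i => c • T i) (‖c‖ * W) := by
  refine h.map hr hW (c • ContinuousLinearMap.id 𝕜 X) ?_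
  rw [norm_smul]
  exact mul_le_of_le_one_right (norm_nonneg c) ContinuousLinearMap.norm_id_le

lemma seqLrNorm_nonneg (a : ℕ → ℝ) : 0 ≤ seqLrNorm r a := by
  unfold seqLrNorm
  split_ifs
  · exact Real.iSup_nonneg fun _ => abs_nonneg _
  · exact Real.rpow_nonneg (tsum_nonneg fun _ => Real.rpow_nonneg (abs_nonneg _) _) _

lemma weakNorm_nonneg (T : ℕ → X) : 0 ≤ weakNorm 𝕜 r T :=
  Real.iSup_nonneg fun _ => seqLrNorm_nonneg _

lemma LrBound.seqLrNorm_le (hr : r ≠ 0) {b : ℕ → ℝ} {W : ℝ} (hb : ∀ i, 0 ≤ b i) (hW : 0 ≤ W)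
    (h : LrBound r b W) : seqLrNorm r b ≤ W := by
  unfold seqLrNorm
  simp_rw [fun j => abs_of_nonneg (hb j)]
  split_ifs with hr'
  · subst hr'
    exact ciSup_le (lrBound_top.1 h)
  · exact h.tsum_rpow_le hr hr' hb hW

lemma LrBound.seqLrNorm_self (hr : r ≠ 0) {b : ℕ → ℝ} {W : ℝ} (hb : ∀ i, 0 ≤ b i)
    (h : LrBound r b W) : LrBound r b (seqLrNorm r b) := by
  unfold seqLrNorm
  simp_rw [fun j => abs_of_nonneg (hb j)]
  split_ifs with hr'
  · subst hr'
    exact lrBound_top.2 fun i => le_ciSup ⟨W, by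
      rintro _ ⟨j, rfl⟩
      exact lrBound_top.1 h j⟩ i
  · exact lrBound_of_summable hr hr' hb (h.summable hr' hb)

lemma WeakBound.weakNorm_le (hr : r ≠ 0) {T : ℕ → X} {W : ℝ} (hW : 0 ≤ W)
    (h : WeakBound 𝕜 r T W) : weakNorm 𝕜 r T ≤ W :=
  have : Nonempty {φ : X →L[𝕜] 𝕜 // ‖φ‖ ≤ 1} := ⟨⟨0, by simp⟩⟩
  ciSup_le fun φ => (h φ.1 φ.2).seqLrNorm_le hr (fun _ => norm_nonneg _) hW

lemma WeakBound.weakNorm_self (hr : r ≠ 0) {T : ℕ → X} {W : ℝ} (hW : 0 ≤ W)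
    (h : WeakBound 𝕜 r T W) : WeakBound 𝕜 r T (weakNorm 𝕜 r T) := by
  intro φ hφ
  refine ((h φ hφ).seqLrNorm_self hr fun _ => norm_nonneg _).mono_right (seqLrNorm_nonneg _) ?_
  refine le_ciSup (f := fun φ : {φ : X →L[𝕜] 𝕜 // ‖φ‖ ≤ 1} =>
    seqLrNorm r fun j => ‖(φ : X →L[𝕜] 𝕜) (T j)‖) ⟨W, ?_⟩ ⟨φ, hφ⟩
  rintro _ ⟨ψ, rfl⟩
  exact (h ψ.1 ψ.2).seqLrNorm_le hr (fun _ => norm_nonneg _) hW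

lemma WeakBound.weaklySummable (hr : r ≠ 0) {T : ℕ → X} {W : ℝ} (hW : 0 ≤ W)
    (h : WeakBound 𝕜 r T W) : WeaklySummable 𝕜 r T := by
  unfold WeaklySummable
  split_ifs with hr'
  · subst hr'
    refine ⟨W, fun j => ?_⟩
    obtain ⟨g, hg, hgj⟩ := exists_dual_vector'' 𝕜 (T j)
    have := lrBound_top.1 (h g hg) j
    simpa [hgj] using this
  · exact fun φ => (h.lrBound_apply hr hW φ le_rfl).summable hr' fun _ => norm_nonneg _

/-- A weakly `r`-summable sequence has finite weak norm, by the uniform boundedness principle. -/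
lemma WeaklySummable.exists_weakBound (hr : 1 ≤ r) {T : ℕ → X} (h : WeaklySummable 𝕜 r T) :
    ∃ W, 0 ≤ W ∧ WeakBound 𝕜 r T W := by
  have hr0 : r ≠ 0 := (zero_lt_one.trans_le hr).ne'
  unfold WeaklySummable at h
  split_ifs at h with hr'
  · subst hr'
    obtain ⟨c, hc⟩ := h
    refine ⟨c, (norm_nonneg _).trans (hc 0), fun φ hφ => lrBound_top.2 fun j => ?_⟩
    exact (φ.le_of_opNorm_le hφ _).trans (by rw [one_mul]; exact hc j)
  · have : Fact (1 ≤ r) := ⟨hr⟩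
    have hrpos := ENNReal.toReal_pos hr0 hr'
    let g : Finset ℕ → (X →L[𝕜] 𝕜) →L[𝕜] lp (fun _ : ℕ => 𝕜) r := fun S =>
      ∑ j ∈ S, (lp.singleContinuousLinearMap 𝕜 (fun _ : ℕ => 𝕜) r j).comp
        (ContinuousLinearMap.apply 𝕜 𝕜 (T j))
    have hg : ∀ S φ, ‖g S φ‖ ^ r.toReal = ∑ j ∈ S, ‖φ (T j)‖ ^ r.toReal := fun S φ => by
      rw [← lp.norm_sum_single hrpos (fun j => φ (T j)) S]
      simp [g]
    obtain ⟨C, hC⟩ := banach_steinhaus (g := g) fun φ =>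
      ⟨(∑' j, ‖φ (T j)‖ ^ r.toReal) ^ (r.toReal)⁻¹, fun S => by
        rw [Real.le_rpow_inv_iff_of_pos (norm_nonneg _)
          (tsum_nonneg fun _ => Real.rpow_nonneg (norm_nonneg _) _) hrpos, hg]
        exact (h φ).sum_le_tsum S fun _ _ => Real.rpow_nonneg (norm_nonneg _) _⟩
    refine ⟨C, (norm_nonneg _).trans (hC ∅), fun φ hφ => (lrBound_of_ne_top hr').2 fun S => ?_⟩
    rw [← hg]
    refine Real.rpow_le_rpow (norm_nonneg _) ?_ hrpos.le
    calc ‖g S φ‖ ≤ C * ‖φ‖ := (g S).le_of_opNorm_le (hC S) φ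
      _ ≤ C * 1 := mul_le_mul_of_nonneg_left hφ ((norm_nonneg _).trans (hC ∅))
      _ = C := mul_one C

lemma WeaklySummable.weakBound (hr : 1 ≤ r) {T : ℕ → X} (h : WeaklySummable 𝕜 r T) :
    WeakBound 𝕜 r T (weakNorm 𝕜 r T) := by
  obtain ⟨W, hW, hT⟩ := h.exists_weakBound hr
  exact hT.weakNorm_self (zero_lt_one.trans_le hr).ne' hW

end WeakBounds

section NormalizedRepresentations

/-- The relations between the exponents `s`, `r` and `p` with `1/p = 1/s + 1/r ≥ 1`. -/
structure NuclearExponents (s : ℝ) (r : ℝ≥0∞) (p : ℝ) : Prop where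
  s_pos : 0 < s
  one_le_r : 1 ≤ r
  p_pos : 0 < p
  p_le_one : p ≤ 1
  add_eq_one : p * ((ENNReal.ofReal s)⁻¹).toReal + p * (r⁻¹).toReal = 1

namespace NuclearExponents

variable {s : ℝ} {r : ℝ≥0∞} {p : ℝ}

lemma r_ne_zero (h : NuclearExponents s r p) : r ≠ 0 := (zero_lt_one.trans_le h.one_le_r).ne'

lemma ofReal_ne_zero (h : NuclearExponents s r p) : ENNReal.ofReal s ≠ 0 :=
  (ENNReal.ofReal_pos.2 h.s_pos).ne'

lemma rpow_mul_rpow (h : NuclearExponents s r p) {a : ℝ} (ha : 0 ≤ a) :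
    a ^ (p * ((ENNReal.ofReal s)⁻¹).toReal) * a ^ (p * (r⁻¹).toReal) = a := by
  have hp := h.p_pos.le
  rw [← Real.rpow_add_of_nonneg ha (by positivity) (by positivity), h.add_eq_one, Real.rpow_one]

end NuclearExponents

variable {𝕜} {s : ℝ} {r : ℝ≥0∞} {p : ℝ} {ι : Type*}
  {n : ℕ} {E : Fin n → Type} [∀ i, NormedAddCommGroup (E i)] [∀ i, NormedSpace 𝕜 (E i)]
  {F : Type} [NormedAddCommGroup F] [NormedSpace 𝕜 F]

/-- `(lam, T, y)` represents `A`, with the constant `a` distributed over `lam` and `T` according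
to `1 = p/s + p/r`. -/
structure IsNormalizedRep (s : ℝ) (r : ℝ≥0∞) (p : ℝ) (lam : ι → 𝕜)
    (T : ι → ContinuousMultilinearMap 𝕜 E 𝕜) (y : ι → F)
    (A : ContinuousMultilinearMap 𝕜 E F) (a : ℝ) : Prop where
  lam_bound : LrBound (ENNReal.ofReal s) (fun i => ‖lam i‖)
    (a ^ (p * ((ENNReal.ofReal s)⁻¹).toReal))
  weak_bound : WeakBound 𝕜 r T (a ^ (p * (r⁻¹).toReal))
  norm_le_one : ∀ i, ‖y i‖ ≤ 1
  hasSum : ∀ x, HasSum (fun i => (lam i * T i x) • y i) (A x)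

lemma norm_apply_le_prod (x : ∀ i, E i) :
    ‖ContinuousMultilinearMap.apply 𝕜 E 𝕜 x‖ ≤ ∏ i, ‖x i‖ := by
  refine ContinuousLinearMap.opNorm_le_bound _ (by positivity) fun T => ?_
  rw [mul_comm]
  exact T.le_opNorm x

lemma sum_norm_mul_apply_le (h : NuclearExponents s r p) {lam : ι → 𝕜}
    {T : ι → ContinuousMultilinearMap 𝕜 E 𝕜} {a : ℝ} (ha : 0 ≤ a)
    (hlam : LrBound (ENNReal.ofReal s) (fun i => ‖lam i‖)
      (a ^ (p * ((ENNReal.ofReal s)⁻¹).toReal)))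
    (hT : WeakBound 𝕜 r T (a ^ (p * (r⁻¹).toReal))) (x : ∀ i, E i) (S : Finset ι) :
    ∑ i ∈ S, ‖lam i‖ * ‖T i x‖ ≤ a * ∏ i, ‖x i‖ := by
  have hTx : LrBound r (fun i => ‖T i x‖) ((∏ i, ‖x i‖) * a ^ (p * (r⁻¹).toReal)) :=
    hT.lrBound_apply h.r_ne_zero (Real.rpow_nonneg ha _) _ (norm_apply_le_prod x)
  refine (LrBound.sum_mul_le h.ofReal_ne_zero ENNReal.ofReal_ne_top h.r_ne_zero h.p_pos h.p_le_one
    h.add_eq_one (fun _ => norm_nonneg _) (fun _ => norm_nonneg _) (Real.rpow_nonneg ha _)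
    (by positivity) hlam hTx S).trans_eq ?_
  rw [mul_left_comm, h.rpow_mul_rpow ha, mul_comm]

lemma summable_norm_smul (h : NuclearExponents s r p) {lam : ι → 𝕜}
    {T : ι → ContinuousMultilinearMap 𝕜 E 𝕜} {y : ι → F} {a : ℝ} (ha : 0 ≤ a)
    (hlam : LrBound (ENNReal.ofReal s) (fun i => ‖lam i‖)
      (a ^ (p * ((ENNReal.ofReal s)⁻¹).toReal)))
    (hT : WeakBound 𝕜 r T (a ^ (p * (r⁻¹).toReal))) (hy : ∀ i, ‖y i‖ ≤ 1) (x : ∀ i, E i) :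
    Summable fun i => ‖(lam i * T i x) • y i‖ := by
  refine Summable.of_nonneg_of_le (fun _ => norm_nonneg _) (fun i => ?_)
    (summable_of_sum_le (fun i => by positivity) (sum_norm_mul_apply_le h ha hlam hT x))
  rw [norm_smul, norm_mul]
  exact mul_le_of_le_one_right (by positivity) (hy i)

namespace IsNormalizedRep

variable {lam : ι → 𝕜} {T : ι → ContinuousMultilinearMap 𝕜 E 𝕜} {y : ι → F}
  {A : ContinuousMultilinearMap 𝕜 E F} {a : ℝ}

lemma norm_le (h : NuclearExponents s r p) (ha : 0 ≤ a)
    (hA : IsNormalizedRep s r p lam T y A a) : ‖A‖ ≤ a := by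
  refine A.opNorm_le_bound ha fun x => ?_
  refine le_of_tendsto' (hA.hasSum x).norm fun S => (norm_sum_le _ _).trans ?_
  refine (Finset.sum_le_sum fun i _ => ?_).trans
    (sum_norm_mul_apply_le h ha hA.lam_bound hA.weak_bound x S)
  rw [norm_smul, norm_mul]
  exact mul_le_of_le_one_right (by positivity) (hA.norm_le_one i)

lemma comp_equiv {κ : Type*} (hA : IsNormalizedRep s r p lam T y A a) (e : κ ≃ ι) :
    IsNormalizedRep s r p (lam ∘ e) (T ∘ e) (y ∘ e) A a where
  lam_bound := hA.lam_bound.comp_injective e.injective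
  weak_bound φ hφ := (hA.weak_bound φ hφ).comp_injective e.injective
  norm_le_one k := hA.norm_le_one (e k)
  hasSum x := e.hasSum_iff.2 (hA.hasSum x)

lemma isHyperNuclearRep (h : NuclearExponents s r p) (ha : 0 ≤ a) {lam : ℕ → 𝕜}
    {T : ℕ → ContinuousMultilinearMap 𝕜 E 𝕜} {y : ℕ → F}
    (hA : IsNormalizedRep s r p lam T y A a) : IsHyperNuclearRep 𝕜 s r lam T y A :=
  ⟨hA.lam_bound.memLs h.s_pos, hA.weak_bound.weaklySummable h.r_ne_zero (Real.rpow_nonneg ha _),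
    ⟨1, hA.norm_le_one⟩, hA.hasSum⟩

end IsNormalizedRep

lemma hnNorm_set_bddBelow (A : ContinuousMultilinearMap 𝕜 E F) :
    BddBelow {c : ℝ | ∃ lam T y, IsHyperNuclearRep 𝕜 s r lam T y A ∧
      c = lsNorm 𝕜 s lam * weakNorm 𝕜 r T * ⨆ j, ‖y j‖} := by
  refine ⟨0, ?_⟩
  rintro _ ⟨lam, T, y, -, rfl⟩
  exact mul_nonneg (mul_nonneg (lsNorm_nonneg _) (weakNorm_nonneg _))
    (Real.iSup_nonneg fun _ => norm_nonneg _)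

lemma hnNorm_nonneg (A : ContinuousMultilinearMap 𝕜 E F) : 0 ≤ hnNorm 𝕜 s r A := by
  refine Real.sInf_nonneg ?_
  rintro _ ⟨lam, T, y, -, rfl⟩
  exact mul_nonneg (mul_nonneg (lsNorm_nonneg _) (weakNorm_nonneg _))
    (Real.iSup_nonneg fun _ => norm_nonneg _)

lemma IsHyperNuclearRep.hnNorm_le {A : ContinuousMultilinearMap 𝕜 E F} {lam : ℕ → 𝕜}
    {T : ℕ → ContinuousMultilinearMap 𝕜 E 𝕜} {y : ℕ → F}
    (hA : IsHyperNuclearRep 𝕜 s r lam T y A) {L W Y : ℝ} (hL : lsNorm 𝕜 s lam ≤ L)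
    (hW : weakNorm 𝕜 r T ≤ W) (hY : ∀ j, ‖y j‖ ≤ Y) : hnNorm 𝕜 s r A ≤ L * W * Y :=
  (csInf_le (hnNorm_set_bddBelow A) ⟨lam, T, y, hA, rfl⟩).trans <|
    mul_le_mul (mul_le_mul hL hW (weakNorm_nonneg _) ((lsNorm_nonneg _).trans hL))
      (ciSup_le hY) (Real.iSup_nonneg fun _ => norm_nonneg _)
      (mul_nonneg ((lsNorm_nonneg _).trans hL) ((weakNorm_nonneg _).trans hW))

lemma IsNormalizedRep.hnNorm_le (h : NuclearExponents s r p)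
    {A : ContinuousMultilinearMap 𝕜 E F} {a : ℝ} (ha : 0 ≤ a) {lam : ℕ → 𝕜}
    {T : ℕ → ContinuousMultilinearMap 𝕜 E 𝕜} {y : ℕ → F}
    (hA : IsNormalizedRep s r p lam T y A a) : hnNorm 𝕜 s r A ≤ a := by
  have := (hA.isHyperNuclearRep h ha).hnNorm_le
    (hA.lam_bound.lsNorm_le h.s_pos (Real.rpow_nonneg ha _))
    (hA.weak_bound.weakNorm_le h.r_ne_zero (Real.rpow_nonneg ha _)) hA.norm_le_one
  rwa [h.rpow_mul_rpow ha, mul_one] at this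

/-- Rescaling a representation so that its constants are distributed over `lam` and `T`. -/
lemma IsHyperNuclearRep.exists_normalizedRep (h : NuclearExponents s r p)
    {A : ContinuousMultilinearMap 𝕜 E F} {lam : ℕ → 𝕜}
    {T : ℕ → ContinuousMultilinearMap 𝕜 E 𝕜} {y : ℕ → F}
    (hA : IsHyperNuclearRep 𝕜 s r lam T y A) {L W Y a : ℝ} (hLpos : 0 < L) (hWpos : 0 < W)
    (hL : lsNorm 𝕜 s lam ≤ L) (hW : weakNorm 𝕜 r T ≤ W) (hY : ∀ j, ‖y j‖ ≤ Y) (ha : 0 < a)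
    (hLWY : L * W * Y ≤ a) :
    ∃ (lam : ℕ → 𝕜) (T : ℕ → ContinuousMultilinearMap 𝕜 E 𝕜) (y : ℕ → F),
      IsNormalizedRep s r p lam T y A a := by
  obtain ⟨hlam, hT, -, hsum⟩ := hA
  set a₁ := a ^ (p * ((ENNReal.ofReal s)⁻¹).toReal) with ha₁
  set a₂ := a ^ (p * (r⁻¹).toReal) with ha₂
  have ha₁pos : 0 < a₁ := Real.rpow_pos_of_pos ha _
  have ha₂pos : 0 < a₂ := Real.rpow_pos_of_pos ha _
  have ha₁₂ : a₁ * a₂ = a := h.rpow_mul_rpow ha.le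
  have hnorm : ∀ {c : ℝ}, 0 < c → ‖(c : 𝕜)‖ = c := fun {c} hc => by
    rw [RCLike.norm_ofReal, abs_of_pos hc]
  refine ⟨fun j => ((a₁ / L : ℝ) : 𝕜) * lam j, fun j => ((a₂ / W : ℝ) : 𝕜) • T j,
    fun j => ((L * W / a : ℝ) : 𝕜) • y j, ?_, ?_, fun j => ?_, fun x => ?_⟩
  · have := ((hlam.lrBound h.s_pos).mono_right (lsNorm_nonneg _) hL).const_mul
      (fun _ => norm_nonneg _) hLpos.le (div_pos ha₁pos hLpos).le
    simpa only [norm_mul, hnorm (div_pos ha₁pos hLpos), div_mul_cancel₀ _ hLpos.ne'] using this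
  · have hTW : WeakBound 𝕜 r T W := fun φ hφ =>
      (hT.weakBound h.one_le_r φ hφ).mono_right (weakNorm_nonneg _) hW
    have := hTW.const_smul h.r_ne_zero hWpos.le ((a₂ / W : ℝ) : 𝕜)
    rwa [hnorm (div_pos ha₂pos hWpos), div_mul_cancel₀ _ hWpos.ne'] at this
  · have hc : 0 < L * W / a := by positivity
    rw [norm_smul, hnorm hc, div_mul_eq_mul_div, div_le_one ha]
    exact (mul_le_mul_of_nonneg_left (hY j) (by positivity)).trans hLWY
  · have hc : ((a₁ / L : ℝ) : 𝕜) * ((a₂ / W : ℝ) : 𝕜) * ((L * W / a : ℝ) : 𝕜) = 1 := by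
      rw [← RCLike.ofReal_mul, ← RCLike.ofReal_mul, ← RCLike.ofReal_one, ← ha₁₂]
      congr 1
      field_simp
    convert hsum x using 2 with j
    rw [smul_smul, smul_apply, smul_eq_mul]
    congr 1
    linear_combination (lam j * T j x) * hc

lemma IsHyperNuclear.exists_normalizedRep (h : NuclearExponents s r p)
    {A : ContinuousMultilinearMap 𝕜 E F} (hA : IsHyperNuclear 𝕜 s r A) {a : ℝ}
    (ha : hnNorm 𝕜 s r A < a) :
    ∃ (lam : ℕ → 𝕜) (T : ℕ → ContinuousMultilinearMap 𝕜 E 𝕜) (y : ℕ → F),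
      IsNormalizedRep s r p lam T y A a := by
  obtain ⟨lam₀, T₀, y₀, hA₀⟩ := hA
  obtain ⟨_, ⟨lam, T, y, hrep, rfl⟩, hlt⟩ :=
    exists_lt_of_csInf_lt (by exact ⟨_, lam₀, T₀, y₀, hA₀, rfl⟩) ha
  have htend : Tendsto (fun δ : ℝ => (lsNorm 𝕜 s lam + δ) * (weakNorm 𝕜 r T + δ) * ⨆ j, ‖y j‖)
      (𝓝[>] 0) (𝓝 ((lsNorm 𝕜 s lam + 0) * (weakNorm 𝕜 r T + 0) * ⨆ j, ‖y j‖)) :=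
    (Continuous.tendsto (by fun_prop) 0).mono_left nhdsWithin_le_nhds
  rw [add_zero, add_zero] at htend
  obtain ⟨δ, hδa, hδ⟩ := ((htend.eventually_lt_const hlt).and self_mem_nhdsWithin).exists
  obtain ⟨c, hc⟩ := hrep.2.2.1
  have hbdd : BddAbove (Set.range fun j => ‖y j‖) := ⟨c, by
    rintro _ ⟨j, rfl⟩
    exact hc j⟩
  exact hrep.exists_normalizedRep h (add_pos_of_nonneg_of_pos (lsNorm_nonneg _) hδ)
    (add_pos_of_nonneg_of_pos (weakNorm_nonneg _) hδ) (le_add_of_nonneg_right (le_of_lt hδ))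
    (le_add_of_nonneg_right (le_of_lt hδ)) (fun j => le_ciSup hbdd j)
    ((hnNorm_nonneg A).trans_lt ha) hδa.le

lemma IsHyperNuclear.norm_le_hnNorm (h : NuclearExponents s r p)
    {A : ContinuousMultilinearMap 𝕜 E F} (hA : IsHyperNuclear 𝕜 s r A) :
    ‖A‖ ≤ hnNorm 𝕜 s r A := by
  refine le_of_forall_gt_imp_ge_of_dense fun a ha => ?_
  obtain ⟨lam, T, y, hrep⟩ := hA.exists_normalizedRep h ha
  exact hrep.norm_le h ((hnNorm_nonneg A).trans ha.le)

/-- The sum of a series of hyper-nuclear operators with `p`-summable norms is hyper-nuclear. -/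
lemma isHyperNuclear_of_hasSum [CompleteSpace F] (h : NuclearExponents s r p)
    {A : ℕ → ContinuousMultilinearMap 𝕜 E F} {C : ContinuousMultilinearMap 𝕜 E F}
    {a : ℕ → ℝ} {b : ℝ} (ha : ∀ k, 0 ≤ a k) (hb : 0 ≤ b)
    (hA : ∀ k, ∃ (lam : ℕ → 𝕜) (T : ℕ → ContinuousMultilinearMap 𝕜 E 𝕜) (y : ℕ → F),
      IsNormalizedRep s r p lam T y (A k) (a k))
    (hsum : HasSum (fun k => a k ^ p) (b ^ p)) (hC : ∀ x, HasSum (fun k => A k x) (C x)) :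
    IsHyperNuclear 𝕜 s r C ∧ hnNorm 𝕜 s r C ≤ b := by
  choose lam T y hrep using hA
  have hlam := LrBound.uncurry h.ofReal_ne_zero ha hb (fun _ _ => norm_nonneg _)
    (fun k => (hrep k).lam_bound) hsum
  have hT : WeakBound 𝕜 r (fun x : ℕ × ℕ => T x.1 x.2) (b ^ (p * (r⁻¹).toReal)) := fun φ hφ =>
    LrBound.uncurry h.r_ne_zero ha hb (fun _ _ => norm_nonneg _)
      (fun k => (hrep k).weak_bound φ hφ) hsum
  have hprod : IsNormalizedRep s r p (fun x : ℕ × ℕ => lam x.1 x.2) (fun x => T x.1 x.2)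
      (fun x => y x.1 x.2) C b := by
    refine ⟨hlam, hT, fun x => (hrep x.1).norm_le_one x.2, fun x => ?_⟩
    have hs := (summable_norm_smul h hb hlam hT
      (fun x : ℕ × ℕ => (hrep x.1).norm_le_one x.2) x).of_norm
    have := hs.hasSum.prod_fiberwise fun k => (hrep k).hasSum x
    rw [← this.unique (hC x)]
    exact hs.hasSum
  have hnat := hprod.comp_equiv (Denumerable.eqv (ℕ × ℕ)).symm
  exact ⟨⟨_, _, _, hnat.isHyperNuclearRep h hb⟩, hnat.hnNorm_le h hb⟩

end NormalizedRepresentations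

section Ideal

variable {𝕜} {s : ℝ} {r : ℝ≥0∞} {p : ℝ}
  {n : ℕ} {E : Fin n → Type} [∀ i, NormedAddCommGroup (E i)] [∀ i, NormedSpace 𝕜 (E i)]
  {F : Type} [NormedAddCommGroup F] [NormedSpace 𝕜 F]
  {M : ℕ} {G : Fin M → Type} [∀ j, NormedAddCommGroup (G j)] [∀ j, NormedSpace 𝕜 (G j)]
  {H0 : Type} [NormedAddCommGroup H0] [NormedSpace 𝕜 H0]

lemma exists_normalizedRep_zero (h : NuclearExponents s r p) {a : ℝ} (ha : 0 ≤ a) :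
    ∃ (lam : ℕ → 𝕜) (T : ℕ → ContinuousMultilinearMap 𝕜 E 𝕜) (y : ℕ → F),
      IsNormalizedRep s r p lam T y (0 : ContinuousMultilinearMap 𝕜 E F) a := by
  refine ⟨0, 0, 0, ?_, fun φ hφ => ?_, fun _ => by simp, fun x => by simp [hasSum_zero]⟩
  · simpa using lrBound_zero h.ofReal_ne_zero (Real.rpow_nonneg ha _)
  · simpa using lrBound_zero h.r_ne_zero (Real.rpow_nonneg ha _)

lemma isHyperNuclear_zero (h : NuclearExponents s r p) :
    IsHyperNuclear 𝕜 s r (0 : ContinuousMultilinearMap 𝕜 E F) := by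
  obtain ⟨_, _, _, hrep⟩ := exists_normalizedRep_zero (𝕜 := 𝕜) (E := E) (F := F) h le_rfl
  exact ⟨_, _, _, hrep.isHyperNuclearRep h le_rfl⟩

lemma hnNorm_zero (h : NuclearExponents s r p) :
    hnNorm 𝕜 s r (0 : ContinuousMultilinearMap 𝕜 E F) = 0 := by
  obtain ⟨_, _, _, hrep⟩ := exists_normalizedRep_zero (𝕜 := 𝕜) (E := E) (F := F) h le_rfl
  exact le_antisymm (hrep.hnNorm_le h le_rfl) (hnNorm_nonneg _)

lemma IsHyperNuclear.add_of_lt [CompleteSpace F] (h : NuclearExponents s r p)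
    {A B : ContinuousMultilinearMap 𝕜 E F} (hA : IsHyperNuclear 𝕜 s r A)
    (hB : IsHyperNuclear 𝕜 s r B) {a b : ℝ} (ha : hnNorm 𝕜 s r A < a)
    (hb : hnNorm 𝕜 s r B < b) :
    IsHyperNuclear 𝕜 s r (A + B) ∧ hnNorm 𝕜 s r (A + B) ^ p ≤ a ^ p + b ^ p := by
  have ha0 : 0 ≤ a := (hnNorm_nonneg A).trans ha.le
  have hb0 : 0 ≤ b := (hnNorm_nonneg B).trans hb.le
  have hab : 0 ≤ a ^ p + b ^ p := by positivity
  let u : ℕ → ContinuousMultilinearMap 𝕜 E F := fun k => match k with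
    | 0 => A
    | 1 => B
    | _ => 0
  let c : ℕ → ℝ := fun k => match k with
    | 0 => a
    | 1 => b
    | _ => 0
  have hpow : ((a ^ p + b ^ p) ^ p⁻¹) ^ p = a ^ p + b ^ p :=
    Real.rpow_inv_rpow hab h.p_pos.ne'
  have key : IsHyperNuclear 𝕜 s r (A + B) ∧ hnNorm 𝕜 s r (A + B) ≤ (a ^ p + b ^ p) ^ p⁻¹ := by
    refine isHyperNuclear_of_hasSum h (A := u) (a := c) ?_ (Real.rpow_nonneg hab _) ?_ ?_ ?_
    · rintro (_ | _ | k)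
      exacts [ha0, hb0, le_rfl]
    · rintro (_ | _ | k)
      exacts [hA.exists_normalizedRep h ha, hB.exists_normalizedRep h hb,
        exists_normalizedRep_zero h le_rfl]
    · rw [hpow]
      have : HasSum (fun k => c k ^ p) (∑ k ∈ Finset.range 2, c k ^ p) := hasSum_sum_of_ne_finset_zero (by
        rintro (_ | _ | k) hk
        · simp at hk
        · simp at hk
        · exact Real.zero_rpow h.p_pos.ne')
      simpa [Finset.sum_range_succ, c] using this
    · intro x
      have : HasSum (fun k => u k x) (∑ k ∈ Finset.range 2, u k x) := hasSum_sum_of_ne_finset_zero (by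
        rintro (_ | _ | k) hk
        · simp at hk
        · simp at hk
        · simp [u])
      simpa [Finset.sum_range_succ, u] using this
  refine ⟨key.1, ?_⟩
  rw [← hpow]
  exact Real.rpow_le_rpow (hnNorm_nonneg _) key.2 h.p_pos.le

lemma IsHyperNuclear.add [CompleteSpace F] (h : NuclearExponents s r p)
    {A B : ContinuousMultilinearMap 𝕜 E F} (hA : IsHyperNuclear 𝕜 s r A)
    (hB : IsHyperNuclear 𝕜 s r B) : IsHyperNuclear 𝕜 s r (A + B) :=
  (hA.add_of_lt h hB (lt_add_one _) (lt_add_one _)).1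

lemma IsHyperNuclear.hnNorm_add_le [CompleteSpace F] (h : NuclearExponents s r p)
    {A B : ContinuousMultilinearMap 𝕜 E F} (hA : IsHyperNuclear 𝕜 s r A)
    (hB : IsHyperNuclear 𝕜 s r B) :
    hnNorm 𝕜 s r (A + B) ^ p ≤ hnNorm 𝕜 s r A ^ p + hnNorm 𝕜 s r B ^ p := by
  have hcont : Continuous fun δ : ℝ => (hnNorm 𝕜 s r A + δ) ^ p + (hnNorm 𝕜 s r B + δ) ^ p :=
    ((continuous_const.add continuous_id).rpow_const fun _ => Or.inr h.p_pos.le).add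
      ((continuous_const.add continuous_id).rpow_const fun _ => Or.inr h.p_pos.le)
  have htend := (hcont.tendsto 0).mono_left (nhdsWithin_le_nhds (s := Set.Ioi 0))
  simp only [add_zero] at htend
  refine ge_of_tendsto htend ?_
  filter_upwards [self_mem_nhdsWithin] with δ hδ
  exact (hA.add_of_lt h hB (lt_add_of_pos_right _ hδ) (lt_add_of_pos_right _ hδ)).2

/-- Hyper-nuclear operators are stable under composition with a bounded operator on the left and
with a substitution `g` on the right which acts boundedly on multilinear forms. -/
lemma IsHyperNuclear.comp (h : NuclearExponents s r p) {A : ContinuousMultilinearMap 𝕜 E F}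
    (hA : IsHyperNuclear 𝕜 s r A) (t : F →L[𝕜] H0)
    (Φ : ContinuousMultilinearMap 𝕜 E 𝕜 →L[𝕜] ContinuousMultilinearMap 𝕜 G 𝕜)
    (g : (∀ j, G j) → ∀ i, E i) (hΦ : ∀ T x, Φ T x = T (g x))
    {C : ContinuousMultilinearMap 𝕜 G H0} (hC : ∀ x, C x = t (A (g x))) {τ K : ℝ}
    (ht : ‖t‖ ≤ τ) (hK : ‖Φ‖ ≤ K) :
    IsHyperNuclear 𝕜 s r C ∧ hnNorm 𝕜 s r C ≤ τ * hnNorm 𝕜 s r A * K := by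
  have hτ0 : 0 ≤ τ := (norm_nonneg t).trans ht
  have hK0 : 0 ≤ K := (norm_nonneg Φ).trans hK
  have key : ∀ lam T y, IsHyperNuclearRep 𝕜 s r lam T y A →
      IsHyperNuclear 𝕜 s r C ∧
        hnNorm 𝕜 s r C ≤ (τ * K) * (lsNorm 𝕜 s lam * weakNorm 𝕜 r T * ⨆ j, ‖y j‖) := by
    rintro lam T y ⟨hlam, hT, ⟨c, hc⟩, hsum⟩
    have hΦT := (hT.weakBound h.one_le_r).map h.r_ne_zero (weakNorm_nonneg _) Φ hK
    have hW : 0 ≤ K * weakNorm 𝕜 r T := mul_nonneg hK0 (weakNorm_nonneg _)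
    have hbdd : BddAbove (Set.range fun j => ‖y j‖) := ⟨c, by
      rintro _ ⟨j, rfl⟩
      exact hc j⟩
    have hty : ∀ j, ‖t (y j)‖ ≤ τ * ⨆ j, ‖y j‖ := fun j =>
      (t.le_of_opNorm_le ht _).trans (mul_le_mul_of_nonneg_left (le_ciSup hbdd j) hτ0)
    have hrep : IsHyperNuclearRep 𝕜 s r lam (fun j => Φ (T j)) (fun j => t (y j)) C := by
      refine ⟨hlam, hΦT.weaklySummable h.r_ne_zero hW, ⟨_, hty⟩, fun x => ?_⟩
      rw [hC]
      simpa [hΦ] using (hsum (g x)).mapL t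
    refine ⟨⟨_, _, _, hrep⟩, ?_⟩
    refine (hrep.hnNorm_le le_rfl (hΦT.weakNorm_le h.r_ne_zero hW) hty).trans_eq ?_
    ring
  obtain ⟨lam₀, T₀, y₀, hA₀⟩ := hA
  refine ⟨(key _ _ _ hA₀).1, ?_⟩
  rw [mul_right_comm]
  rcases (mul_nonneg hτ0 hK0).eq_or_lt with h0 | hpos
  · have := (key _ _ _ hA₀).2
    rwa [← h0, zero_mul] at this ⊢
  · rw [← div_le_iff₀' hpos]
    refine le_csInf ⟨_, lam₀, T₀, y₀, hA₀, rfl⟩ ?_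
    rintro _ ⟨lam, T, y, hrep, rfl⟩
    rw [div_le_iff₀' hpos]
    exact (key _ _ _ hrep).2

lemma IsHyperNuclear.smul_and_le (h : NuclearExponents s r p)
    {A : ContinuousMultilinearMap 𝕜 E F} (hA : IsHyperNuclear 𝕜 s r A) (c : 𝕜) :
    IsHyperNuclear 𝕜 s r (c • A) ∧ hnNorm 𝕜 s r (c • A) ≤ ‖c‖ * hnNorm 𝕜 s r A := by
  have hc : ‖c • ContinuousLinearMap.id 𝕜 F‖ ≤ ‖c‖ := by
    rw [norm_smul]
    exact mul_le_of_le_one_right (norm_nonneg c) ContinuousLinearMap.norm_id_le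
  have := hA.comp h (c • ContinuousLinearMap.id 𝕜 F) (ContinuousLinearMap.id 𝕜 _) id
    (fun _ _ => rfl) (C := c • A) (fun _ => rfl) hc ContinuousLinearMap.norm_id_le
  rwa [mul_one] at this

lemma IsHyperNuclear.smul (h : NuclearExponents s r p) {A : ContinuousMultilinearMap 𝕜 E F}
    (hA : IsHyperNuclear 𝕜 s r A) (c : 𝕜) : IsHyperNuclear 𝕜 s r (c • A) :=
  (hA.smul_and_le h c).1

lemma IsHyperNuclear.hnNorm_smul (h : NuclearExponents s r p)
    {A : ContinuousMultilinearMap 𝕜 E F} (hA : IsHyperNuclear 𝕜 s r A) (c : 𝕜) :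
    hnNorm 𝕜 s r (c • A) = ‖c‖ * hnNorm 𝕜 s r A := by
  refine le_antisymm (hA.smul_and_le h c).2 ?_
  rcases eq_or_ne c 0 with rfl | hc
  · simpa using hnNorm_nonneg _
  · have := ((hA.smul h c).smul_and_le h c⁻¹).2
    rwa [inv_smul_smul₀ hc, norm_inv, ← div_eq_inv_mul, le_div_iff₀' (norm_pos_iff.2 hc)] at this

lemma IsHyperNuclear.sub [CompleteSpace F] (h : NuclearExponents s r p)
    {A B : ContinuousMultilinearMap 𝕜 E F} (hA : IsHyperNuclear 𝕜 s r A)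
    (hB : IsHyperNuclear 𝕜 s r B) : IsHyperNuclear 𝕜 s r (A - B) := by
  have := hA.add h (hB.smul h (-1))
  rwa [neg_one_smul, ← sub_eq_add_neg] at this

lemma hnNorm_sub_comm (h : NuclearExponents s r p) {A B : ContinuousMultilinearMap 𝕜 E F}
    (hAB : IsHyperNuclear 𝕜 s r (A - B)) : hnNorm 𝕜 s r (B - A) = hnNorm 𝕜 s r (A - B) := by
  have := hAB.hnNorm_smul h (-1)
  rwa [neg_one_smul, neg_sub, norm_neg, norm_one, one_mul] at this

/-- Rank-one operators `x ↦ T x • y` are hyper-nuclear. -/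
lemma isHyperNuclear_of_eq_smul (h : NuclearExponents s r p)
    {A : ContinuousMultilinearMap 𝕜 E F} (T : ContinuousMultilinearMap 𝕜 E 𝕜) (y : F)
    (hA : ∀ x, A x = T x • y) :
    IsHyperNuclear 𝕜 s r A ∧ hnNorm 𝕜 s r A ≤ ‖T‖ * ‖y‖ := by
  have hlam : LrBound (ENNReal.ofReal s) (fun j : ℕ => ‖if j = 0 then (1 : 𝕜) else 0‖) 1 := by
    refine (lrBound_single h.ofReal_ne_zero 0 zero_le_one).mono_left (fun _ => norm_nonneg _)
      fun j => ?_
    split_ifs <;> simp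
  have hT : WeakBound 𝕜 r (fun j : ℕ => if j = 0 then T else 0) ‖T‖ := fun φ hφ => by
    refine (lrBound_single h.r_ne_zero 0 (norm_nonneg T)).mono_left (fun _ => norm_nonneg _)
      fun j => ?_
    by_cases hj : j = 0
    · simpa [hj] using φ.le_of_opNorm_le hφ T
    · simp [hj]
  have hrep : IsHyperNuclearRep 𝕜 s r (fun j : ℕ => if j = 0 then (1 : 𝕜) else 0)
      (fun j => if j = 0 then T else 0) (fun _ => y) A := by
    refine ⟨hlam.memLs h.s_pos, hT.weaklySummable h.r_ne_zero (norm_nonneg T),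
      ⟨‖y‖, fun _ => le_rfl⟩, fun x => ?_⟩
    rw [hA]
    convert hasSum_ite_eq (0 : ℕ) (T x • y) using 2 with j
    by_cases hj : j = 0 <;> simp [hj]
  refine ⟨⟨_, _, _, hrep⟩, ?_⟩
  have := hrep.hnNorm_le (hlam.lsNorm_le h.s_pos zero_le_one)
    (hT.weakNorm_le h.r_ne_zero (norm_nonneg T)) fun _ => le_rfl
  rwa [one_mul] at this

lemma IsFiniteType.isHyperNuclear [CompleteSpace F] (h : NuclearExponents s r p)
    {A : ContinuousMultilinearMap 𝕜 E F} (hA : IsFiniteType 𝕜 A) : IsHyperNuclear 𝕜 s r A := by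
  refine Submodule.span_induction ?_ (isHyperNuclear_zero h) (fun _ _ _ _ h₁ h₂ => h₁.add h h₂)
    (fun c _ _ h₁ => h₁.smul h c) hA
  rintro B ⟨φ, y, hB⟩
  exact (isHyperNuclear_of_eq_smul h
    ((ContinuousMultilinearMap.mkPiAlgebra 𝕜 (Fin n) 𝕜).compContinuousLinearMap φ) y
    fun x => by simp [hB]).1

lemma hnNorm_mkPiAlgebra (h : NuclearExponents s r p) (n : ℕ) :
    hnNorm 𝕜 s r (ContinuousMultilinearMap.mkPiAlgebra 𝕜 (Fin n) 𝕜) = 1 := by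
  have key := isHyperNuclear_of_eq_smul h
    (A := ContinuousMultilinearMap.mkPiAlgebra 𝕜 (Fin n) 𝕜)
    (ContinuousMultilinearMap.mkPiAlgebra 𝕜 (Fin n) 𝕜) 1 fun x => by simp
  have hle := key.1.norm_le_hnNorm h
  rw [ContinuousMultilinearMap.norm_mkPiAlgebra] at key hle
  refine le_antisymm (key.2.trans ?_) hle
  simp

/-- The substitution of the blocks `B₁, …, Bₙ` into a multilinear form. -/
def blockComp (f : Fin M → Fin n)
    (B : ∀ i : Fin n, ContinuousMultilinearMap 𝕜 (fun j : {j : Fin M // f j = i} => G j.1) (E i))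
    (T : ContinuousMultilinearMap 𝕜 E 𝕜) : ContinuousMultilinearMap 𝕜 G 𝕜 :=
  have key : ∀ [DecidableEq (Fin M)] (m : ∀ j, G j) (j₀ : Fin M) (v : G j₀),
      (fun i => B i fun j => Function.update m j₀ v j.1) =
        Function.update (fun i => B i fun j => m j.1) (f j₀)
          (B (f j₀) (Function.update (fun j => m j.1) ⟨j₀, rfl⟩ v)) := by
    intro _ m j₀ v
    funext i
    by_cases hi : i = f j₀
    · subst hi
      rw [Function.update_self]
      congr 1
      funext j
      by_cases hj : j = ⟨j₀, rfl⟩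
      · subst hj
        simp
      · rw [Function.update_of_ne hj, Function.update_of_ne]
        exact fun h => hj (Subtype.ext h)
    · rw [Function.update_of_ne hi]
      congr 1
      funext j
      refine Function.update_of_ne (fun h => hi ?_) _ _
      rw [← h, j.2]
  { toFun := fun x => T fun i => B i fun j => x j.1
    map_update_add' := fun m j₀ v w => by
      rw [key, key, key, ContinuousMultilinearMap.map_update_add,
        ContinuousMultilinearMap.map_update_add]
    map_update_smul' := fun m j₀ c v => by
      rw [key, key, ContinuousMultilinearMap.map_update_smul,
        ContinuousMultilinearMap.map_update_smul]
    cont := T.cont.comp (continuous_pi fun i => (B i).cont.comp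
      (continuous_pi fun j => continuous_apply j.1)) }

lemma norm_blockComp_le (f : Fin M → Fin n)
    (B : ∀ i : Fin n, ContinuousMultilinearMap 𝕜 (fun j : {j : Fin M // f j = i} => G j.1) (E i))
    (T : ContinuousMultilinearMap 𝕜 E 𝕜) : ‖blockComp f B T‖ ≤ (∏ i, ‖B i‖) * ‖T‖ := by
  refine ContinuousMultilinearMap.opNorm_le_bound (by positivity) fun x => ?_
  calc ‖T fun i => B i fun j => x j.1‖
      ≤ ‖T‖ * ∏ i, ‖B i fun j => x j.1‖ := T.le_opNorm _
    _ ≤ ‖T‖ * ∏ i, (‖B i‖ * ∏ j : {j : Fin M // f j = i}, ‖x j.1‖) := by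
        gcongr with i
        exact (B i).le_opNorm _
    _ = (∏ i, ‖B i‖) * ‖T‖ * ∏ j, ‖x j‖ := by
        rw [Finset.prod_mul_distrib, Fintype.prod_fiberwise f fun j => ‖x j‖]
        ring

/-- `blockComp` as a continuous linear map in the form. -/
def blockCompL (f : Fin M → Fin n)
    (B : ∀ i : Fin n, ContinuousMultilinearMap 𝕜 (fun j : {j : Fin M // f j = i} => G j.1) (E i)) :
    ContinuousMultilinearMap 𝕜 E 𝕜 →L[𝕜] ContinuousMultilinearMap 𝕜 G 𝕜 :=
  LinearMap.mkContinuous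
    { toFun := blockComp f B
      map_add' := fun _ _ => rfl
      map_smul' := fun _ _ => rfl } (∏ i, ‖B i‖) (norm_blockComp_le f B)

lemma IsHyperNuclear.blockComp (h : NuclearExponents s r p)
    {A : ContinuousMultilinearMap 𝕜 E F} (hA : IsHyperNuclear 𝕜 s r A) {f : Fin M → Fin n}
    {B : ∀ i : Fin n, ContinuousMultilinearMap 𝕜 (fun j : {j : Fin M // f j = i} => G j.1) (E i)}
    {t : F →L[𝕜] H0} {C : ContinuousMultilinearMap 𝕜 G H0} (hC : IsBlockComp 𝕜 f B A t C) :
    IsHyperNuclear 𝕜 s r C ∧ hnNorm 𝕜 s r C ≤ ‖t‖ * hnNorm 𝕜 s r A * ∏ i, ‖B i‖ :=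
  hA.comp h t (blockCompL f B) (fun x i => B i fun j => x j.1) (fun _ _ => rfl) hC le_rfl
    (LinearMap.mkContinuous_norm_le _ (by positivity) _)

/-- The limit of an `hnNorm`-Cauchy sequence converging in operator norm. -/
lemma isHyperNuclear_sub_of_cauchy [CompleteSpace F] (h : NuclearExponents s r p)
    {u : ℕ → ContinuousMultilinearMap 𝕜 E F} (hu : ∀ k, IsHyperNuclear 𝕜 s r (u k))
    (hcau : ∀ ε : ℝ, 0 < ε → ∃ K : ℕ, ∀ k ≥ K, ∀ l ≥ K, hnNorm 𝕜 s r (u k - u l) < ε)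
    {A : ContinuousMultilinearMap 𝕜 E F} (hlim : Tendsto u atTop (𝓝 A)) {ε : ℝ} (hε : 0 < ε) :
    ∃ K : ℕ, ∀ k ≥ K, IsHyperNuclear 𝕜 s r (A - u k) ∧ hnNorm 𝕜 s r (A - u k) ≤ ε := by
  let a : ℕ → ℝ := fun i => (ε ^ p * (1 / 2 / 2 ^ i)) ^ p⁻¹
  have ha : ∀ i, 0 < a i := fun i => by positivity
  have hap : ∀ i, a i ^ p = ε ^ p * (1 / 2 / 2 ^ i) := fun i =>
    Real.rpow_inv_rpow (by positivity) h.p_pos.ne'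
  have hsum : HasSum (fun i => a i ^ p) (ε ^ p) := by
    simp_rw [hap]
    simpa using (hasSum_geometric_two' 1).mul_left (ε ^ p)
  choose K hK using fun i => hcau (a i) (ha i)
  refine ⟨K 0, fun k hk => ?_⟩
  let κ : ℕ → ℕ := fun i => k + ∑ j ∈ Finset.range i, (K (j + 1) + 1)
  have hκ_succ : ∀ i, κ (i + 1) = κ i + (K (i + 1) + 1) := fun i => by
    simp only [κ, Finset.sum_range_succ]
    omega
  have hκK : ∀ i, K i ≤ κ i := by
    rintro (_ | i)
    · simpa [κ] using hk
    · rw [hκ_succ]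
      omega
  have hdiff : ∀ i, hnNorm 𝕜 s r (u (κ (i + 1)) - u (κ i)) < a i := fun i =>
    hK i _ ((hκK i).trans (by rw [hκ_succ]; omega)) _ (hκK i)
  have hκ_tend : Tendsto κ atTop atTop := by
    refine (strictMono_nat_of_lt_succ fun i => ?_).tendsto_atTop
    rw [hκ_succ]
    omega
  refine isHyperNuclear_of_hasSum h (A := fun i => u (κ (i + 1)) - u (κ i))
    (fun i => (ha i).le) hε.le (fun i => ?_) hsum fun x => ?_
  · exact ((hu _).sub h (hu _)).exists_normalizedRep h (hdiff i)
  · have hnorm : Summable fun i => ‖(u (κ (i + 1)) - u (κ i)) x‖ := by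
      have ha_le : ∀ i, a i ≤ ε * (1 / 2 / 2 ^ i) := fun i => by
        simp only [a]
        rw [Real.mul_rpow (by positivity) (by positivity), Real.rpow_rpow_inv hε.le h.p_pos.ne']
        refine mul_le_mul_of_nonneg_left (Real.rpow_le_self_of_le_one (by positivity) ?_
          ((one_le_inv₀ h.p_pos).2 h.p_le_one)) hε.le
        exact div_le_one_of_le₀ ((by norm_num : (1 / 2 : ℝ) ≤ 1).trans
          (one_le_pow₀ one_le_two)) (by positivity)
      refine Summable.of_nonneg_of_le (fun _ => norm_nonneg _) (fun i => ?_)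
        (((hasSum_geometric_two' 1).mul_left ε).summable.mul_right (∏ j, ‖x j‖))
      refine (ContinuousMultilinearMap.le_opNorm _ x).trans
        (mul_le_mul_of_nonneg_right ?_ (by positivity))
      exact ((((hu _).sub h (hu _)).norm_le_hnNorm h).trans (hdiff i).le).trans (ha_le i)
    have htend : Tendsto (fun i => u (κ i) x) atTop (𝓝 (A x)) :=
      ((ContinuousMultilinearMap.apply 𝕜 E F x).continuous.tendsto A).comp (hlim.comp hκ_tend)
    refine (hnorm.of_norm.hasSum_iff_tendsto_nat).2 ?_
    have hpartial : ∀ N, ∑ i ∈ Finset.range N, (u (κ (i + 1)) - u (κ i)) x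
        = u (κ N) x - u k x := fun N => by
      have := Finset.sum_range_sub (fun i => u (κ i) x) N
      simpa [κ] using this
    simp_rw [hpartial]
    exact htend.sub_const _

/-- Completeness of the hyper-nuclear norm. -/
lemma exists_hnNorm_limit [CompleteSpace F] (h : NuclearExponents s r p)
    {u : ℕ → ContinuousMultilinearMap 𝕜 E F} (hu : ∀ k, IsHyperNuclear 𝕜 s r (u k))
    (hcau : ∀ ε : ℝ, 0 < ε → ∃ K : ℕ, ∀ k ≥ K, ∀ l ≥ K, hnNorm 𝕜 s r (u k - u l) < ε) :
    ∃ A : ContinuousMultilinearMap 𝕜 E F, IsHyperNuclear 𝕜 s r A ∧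
      Tendsto (fun k => hnNorm 𝕜 s r (u k - A)) atTop (𝓝 0) := by
  have hcauchy : CauchySeq u := Metric.cauchySeq_iff.2 fun ε hε => by
    obtain ⟨K, hK⟩ := hcau ε hε
    refine ⟨K, fun k hk l hl => ?_⟩
    rw [dist_eq_norm]
    exact (((hu k).sub h (hu l)).norm_le_hnNorm h).trans_lt (hK k hk l hl)
  obtain ⟨A, hlim⟩ := cauchySeq_tendsto_of_complete hcauchy
  have hsub := fun {ε : ℝ} (hε : 0 < ε) => isHyperNuclear_sub_of_cauchy h hu hcau hlim hε
  refine ⟨A, ?_, Metric.tendsto_atTop.2 fun ε hε => ?_⟩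
  · obtain ⟨K, hK⟩ := hsub one_pos
    simpa using (hK K le_rfl).1.add h (hu K)
  · obtain ⟨K, hK⟩ := hsub (half_pos hε)
    refine ⟨K, fun k hk => ?_⟩
    obtain ⟨hmem, hle⟩ := hK k hk
    rw [Real.dist_0_eq_abs, abs_of_nonneg (hnNorm_nonneg _), hnNorm_sub_comm h hmem]
    exact hle.trans_lt (half_lt_self hε)

end Ideal

lemma NuclearExponents.of_one_div {s : ℝ} {r : ℝ≥0∞} (hs : 0 < s) (hr : 1 ≤ r)
    (hsr : 1 ≤ 1 / s + (r⁻¹).toReal) {p : ℝ} (hp : 1 / p = 1 / s + (r⁻¹).toReal) :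
    NuclearExponents s r p := by
  rw [← hp] at hsr
  have hp0 : 0 < p := one_div_pos.1 (zero_lt_one.trans_le hsr)
  refine ⟨hs, hr, hp0, ?_, ?_⟩
  · rwa [le_div_iff₀ hp0, one_mul] at hsr
  · rw [ENNReal.toReal_inv, ENNReal.toReal_ofReal hs.le, ← mul_add, ← one_div, ← hp,
      mul_one_div_cancel hp0.ne']

/-- For `0 < s`, `1 ≤ r ≤ ∞` with `1 ≤ 1/s + 1/r` and `1/p = 1/s + 1/r`, the class of
hyper-`(s,r)`-nuclear multilinear operators with the hyper-`(s,r)`-nuclear norm is a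
`p`-Banach hyper-ideal. -/
theorem hyperNuclear_isPBanachHyperIdeal (s : ℝ) (r : ℝ≥0∞) (hs : 0 < s) (hr : 1 ≤ r)
    (hsr : 1 ≤ 1 / s + (r⁻¹).toReal) (p : ℝ) (hp : 1 / p = 1 / s + (r⁻¹).toReal) :
    IsPBanachHyperIdeal 𝕜 (hnClass 𝕜 s r) (hnMultiNorm 𝕜 s r) p := by
  have h : NuclearExponents s r p := .of_one_div hs hr hsr hp
  exact
  { zero_mem := fun _ _ _ _ _ _ _ _ _ => isHyperNuclear_zero h
    add_mem := fun _ _ _ _ _ _ _ _ _ _ _ hA hB => IsHyperNuclear.add h hA hB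
    smul_mem := fun _ _ _ _ _ _ _ _ _ c _ hA => IsHyperNuclear.smul h hA c
    comp_mem := fun _ _ _ _ _ _ _ _ _ _ _ _ _ _ _ _ _ _ _ _ _ _ _ hA _ _ hC =>
      (IsHyperNuclear.blockComp h hA hC).1
    finiteType_mem := fun _ _ _ _ _ _ _ _ _ _ hA => hA.isHyperNuclear h
    p_pos := h.p_pos
    p_le_one := h.p_le_one
    norm_nonneg' := fun _ _ _ _ _ _ _ _ _ A => hnNorm_nonneg A
    norm_eq_zero_iff := fun _ _ _ _ _ _ _ _ _ A hA =>
      ⟨fun h0 => norm_le_zero_iff.1 ((IsHyperNuclear.norm_le_hnNorm h hA).trans_eq h0),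
        fun h0 => h0 ▸ hnNorm_zero h⟩
    norm_smul := fun _ _ _ _ _ _ _ _ _ c _ hA => IsHyperNuclear.hnNorm_smul h hA c
    norm_add_le := fun _ _ _ _ _ _ _ _ _ _ _ hA hB => IsHyperNuclear.hnNorm_add_le h hA hB
    norm_In := hnNorm_mkPiAlgebra h
    norm_comp_le := fun _ _ _ _ _ _ _ _ _ _ _ _ _ _ _ _ _ _ _ _ _ _ _ hA _ _ hC =>
      (IsHyperNuclear.blockComp h hA hC).2
    complete := fun _ _ _ _ _ _ _ _ _ _ hu hcau => exists_hnNorm_limit h hu hcau }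

end
end

section
/- The class (L_{HN},‖·‖_{HN}) of hyper-nuclear multilinear operators is the smallest Banach hyper-ideal: if (H,‖·‖_H) is any Banach hyper-ideal, then every hyper-nuclear operator A ∈ L_{HN}(E1,…,En;F) belongs to H(E1,…,En;F) and ‖A‖_H ≤ ‖A‖_{HN}. -/
open Filter Topology
open scoped ENNReal NNReal BigOperators

noncomputable section

variable (𝕜 : Type) [RCLike 𝕜]

section Helpers

variable {𝕜}

/-- Transport of a multilinear map along the identification of the index type with a
subtype that contains all indices. -/
def ContinuousMultilinearMap.onFullSubtype {ι : Type} {P : ι → Prop} (hP : ∀ j, P j)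
    {G : ι → Type} [∀ j, NormedAddCommGroup (G j)] [∀ j, NormedSpace 𝕜 (G j)]
    {F : Type} [NormedAddCommGroup F] [NormedSpace 𝕜 F] (T : ContinuousMultilinearMap 𝕜 G F) :
    ContinuousMultilinearMap 𝕜 (fun j : {j : ι // P j} => G j.1) F :=
  have update_eq [DecidableEq {j : ι // P j}] [DecidableEq ι]
      (x : ∀ j : {j : ι // P j}, G j.1) (i : {j : ι // P j}) (c : G i.1) :
      (fun j => Function.update x i c ⟨j, hP j⟩) =
        Function.update (fun j => x ⟨j, hP j⟩) i.1 c := by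
    obtain ⟨i, hi⟩ := i
    funext j
    by_cases h : j = i
    · subst h
      simp
    · rw [Function.update_of_ne h, Function.update_of_ne (by simpa using h)]
  { toFun := fun x => T fun j => x ⟨j, hP j⟩
    map_update_add' := by
      classical
      intro _ x i a b
      simp only [update_eq, T.map_update_add]
    map_update_smul' := by
      classical
      intro _ x i c a
      simp only [update_eq, T.map_update_smul]
    cont := T.cont.comp (continuous_pi fun j => continuous_apply _) }

lemma ContinuousMultilinearMap.norm_onFullSubtype_le {ι : Type} [Fintype ι] {P : ι → Prop}
    [DecidablePred P] (hP : ∀ j, P j)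
    {G : ι → Type} [∀ j, NormedAddCommGroup (G j)] [∀ j, NormedSpace 𝕜 (G j)]
    {F : Type} [NormedAddCommGroup F] [NormedSpace 𝕜 F] (T : ContinuousMultilinearMap 𝕜 G F) :
    ‖T.onFullSubtype hP‖ ≤ ‖T‖ := by
  refine ContinuousMultilinearMap.opNorm_le_bound (norm_nonneg _) fun x => ?_
  refine (T.le_opNorm fun j => x ⟨j, hP j⟩).trans_eq ?_
  congr 1
  exact Fintype.prod_equiv (Equiv.subtypeUnivEquiv hP).symm _ _ fun j => rfl

/-- The supremum over the dual unit ball recovers the norm of each term of a bounded sequence. -/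
lemma norm_le_weakNorm_top {X : Type} [NormedAddCommGroup X] [NormedSpace 𝕜 X] {T : ℕ → X}
    (hT : BddSeq T) (j : ℕ) : ‖T j‖ ≤ weakNorm 𝕜 ⊤ T := by
  obtain ⟨c, hc⟩ := hT
  have bound (φ : {φ : X →L[𝕜] 𝕜 // ‖φ‖ ≤ 1}) (i : ℕ) : |‖φ.1 (T i)‖| ≤ c := by
    rw [abs_norm]
    exact (φ.1.le_of_opNorm_le φ.2 _).trans (by simpa using hc i)
  obtain ⟨φ, hφ, hφj⟩ := exists_dual_vector'' 𝕜 (T j)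
  simp only [weakNorm, seqLrNorm, if_true]
  calc ‖T j‖ = |‖φ (T j)‖| := by simp [hφj]
    _ ≤ ⨆ i, |‖φ (T i)‖| :=
        le_ciSup (f := fun i => |‖φ (T i)‖|)
          ⟨c, Set.forall_mem_range.2 fun i => bound ⟨φ, hφ⟩ i⟩ j
    _ ≤ _ :=
        le_ciSup (f := fun ψ : {φ : X →L[𝕜] 𝕜 // ‖φ‖ ≤ 1} => ⨆ i, |‖ψ.1 (T i)‖|)
          ⟨c, Set.forall_mem_range.2 fun ψ => ciSup_le fun i => bound ψ i⟩ ⟨φ, hφ⟩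

variable {H : MultiClass 𝕜} {Nm : MultiNorm 𝕜}
  {n : ℕ} {E : Fin n → Type} [∀ i, NormedAddCommGroup (E i)]
  [∀ i, NormedSpace 𝕜 (E i)] [∀ i, CompleteSpace (E i)]
  {F : Type} [NormedAddCommGroup F] [NormedSpace 𝕜 F] [CompleteSpace F]

lemma IsHyperIdeal.mkPiAlgebra_mem (hH : IsHyperIdeal 𝕜 H) (n : ℕ) :
    ContinuousMultilinearMap.mkPiAlgebra 𝕜 (Fin n) 𝕜 ∈ H n (fun _ => 𝕜) 𝕜 :=
  hH.finiteType_mem _ _ _ _ <| Submodule.subset_span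
    ⟨fun _ => ContinuousLinearMap.id 𝕜 𝕜, 1, fun x => by simp⟩

lemma IsHyperIdealCore.neg_mem (hH : IsHyperIdealCore 𝕜 H) {A : ContinuousMultilinearMap 𝕜 E F}
    (hA : A ∈ H n E F) : -A ∈ H n E F := by
  simpa using hH.smul_mem n E F (-1) hA

lemma IsHyperIdealCore.sub_mem (hH : IsHyperIdealCore 𝕜 H) {A B : ContinuousMultilinearMap 𝕜 E F}
    (hA : A ∈ H n E F) (hB : B ∈ H n E F) : A - B ∈ H n E F := by
  rw [sub_eq_add_neg]
  exact hH.add_mem n E F hA (hH.neg_mem hB)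

lemma IsHyperIdealCore.sum_mem (hH : IsHyperIdealCore 𝕜 H)
    {a : ℕ → ContinuousMultilinearMap 𝕜 E F} (ha : ∀ j, a j ∈ H n E F) (s : Finset ℕ) :
    ∑ j ∈ s, a j ∈ H n E F :=
  Finset.sum_induction _ (· ∈ H n E F) (fun _ _ => hH.add_mem n E F) (hH.zero_mem n E F)
    fun j _ => ha j

namespace IsPNormedHyperIdeal

lemma norm_neg {p : ℝ} (hH : IsPNormedHyperIdeal 𝕜 H Nm p) {A : ContinuousMultilinearMap 𝕜 E F}
    (hA : A ∈ H n E F) : Nm n E F (-A) = Nm n E F A := by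
  simpa using hH.norm_smul n E F (-1) hA

lemma norm_sum_le (hH : IsPNormedHyperIdeal 𝕜 H Nm 1)
    {a : ℕ → ContinuousMultilinearMap 𝕜 E F} (ha : ∀ j, a j ∈ H n E F)
    (s : Finset ℕ) : Nm n E F (∑ j ∈ s, a j) ≤ ∑ j ∈ s, Nm n E F (a j) := by
  induction s using Finset.cons_induction with
  | empty => simp [(hH.norm_eq_zero_iff n E F (hH.zero_mem n E F)).2]
  | cons i s hi ih =>
    rw [Finset.sum_cons, Finset.sum_cons]
    have := hH.norm_add_le n E F (ha i) (hH.sum_mem ha s)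
    simp only [Real.rpow_one] at this
    linarith

/-- The operator norm is dominated by the norm of a normed hyper-ideal. -/
lemma norm_apply_le {p : ℝ} (hH : IsPNormedHyperIdeal 𝕜 H Nm p)
    {A : ContinuousMultilinearMap 𝕜 E F} (hA : A ∈ H n E F) (x : ∀ i, E i) :
    ‖A x‖ ≤ Nm n E F A * ∏ i, ‖x i‖ := by
  obtain ⟨φ, hφ, hφA⟩ := exists_dual_vector'' 𝕜 (A x)
  have h := hH.norm_comp_le n n (fun _ => 𝕜) E F 𝕜 id monotone_id Function.surjective_id
    (fun i => ContinuousMultilinearMap.mkPiRing 𝕜 _ (x i)) A hA φ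
    (φ (A x) • ContinuousMultilinearMap.mkPiAlgebra 𝕜 (Fin n) 𝕜) (fun z => by
      have hz (i : Fin n) : ∏ j : {j : Fin n // id j = i}, z j.1 = z i :=
        Fintype.prod_eq_single (⟨i, rfl⟩ : {j : Fin n // id j = i})
          fun j hj => absurd (Subtype.ext j.2) hj
      simp only [ContinuousMultilinearMap.mkPiRing_apply, hz, A.map_smul_univ]
      simp [mul_comm])
  rw [hH.norm_smul _ _ _ _ (hH.mkPiAlgebra_mem n), hH.norm_In] at h
  simp only [hφA, ContinuousMultilinearMap.norm_mkPiRing, RCLike.norm_ofReal, abs_norm,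
    mul_one] at h
  refine h.trans ?_
  have := hH.norm_nonneg' n E F A
  gcongr
  exact mul_le_of_le_one_left this hφ

lemma smulRight_mem_and_norm_le {p : ℝ} (hH : IsPNormedHyperIdeal 𝕜 H Nm p)
    (T : ContinuousMultilinearMap 𝕜 E 𝕜) (y : F) :
    T.smulRight y ∈ H n E F ∧ Nm n E F (T.smulRight y) ≤ ‖T‖ * ‖y‖ := by
  rcases n with _ | n
  · have hcomp : IsBlockComp 𝕜 (id : Fin 0 → Fin 0) (fun i => i.elim0)
        (ContinuousMultilinearMap.mkPiAlgebra 𝕜 (Fin 0) 𝕜)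
        (ContinuousLinearMap.toSpanSingleton 𝕜 (T 0 • y)) (T.smulRight y) := fun x => by
      simp [Subsingleton.elim x 0]
    refine ⟨hH.comp_mem _ _ _ _ _ _ _ monotone_id Function.surjective_id _ _
      (hH.mkPiAlgebra_mem 0) _ _ hcomp, ?_⟩
    refine (hH.norm_comp_le _ _ _ _ _ _ _ monotone_id Function.surjective_id _ _
      (hH.mkPiAlgebra_mem 0) _ _ hcomp).trans ?_
    have := T.le_opNorm 0
    simp only [Finset.univ_eq_empty, Finset.prod_empty, mul_one] at this
    simp only [hH.norm_In, ContinuousLinearMap.norm_toSpanSingleton, _root_.norm_smul,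
      Finset.univ_eq_empty, Finset.prod_empty, mul_one]
    gcongr
  · have hfull (i : Fin 1) (j : Fin (n + 1)) : (fun _ => 0 : Fin (n + 1) → Fin 1) j = i :=
      Subsingleton.elim _ _
    have hmono : Monotone (fun _ => 0 : Fin (n + 1) → Fin 1) := monotone_const
    have hsurj : Function.Surjective (fun _ => 0 : Fin (n + 1) → Fin 1) :=
      fun i => ⟨0, hfull i 0⟩
    have hcomp : IsBlockComp 𝕜 (fun _ => 0 : Fin (n + 1) → Fin 1)
        (fun i => T.onFullSubtype (hfull i))
        (ContinuousMultilinearMap.mkPiAlgebra 𝕜 (Fin 1) 𝕜)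
        (ContinuousLinearMap.toSpanSingleton 𝕜 y) (T.smulRight y) := fun x => by
      simp only [ContinuousMultilinearMap.smulRight_apply,
        ContinuousMultilinearMap.mkPiAlgebra_apply, Fin.prod_univ_one,
        ContinuousLinearMap.toSpanSingleton_apply]
      rfl
    refine ⟨hH.comp_mem _ _ _ _ _ _ _ hmono hsurj _ _ (hH.mkPiAlgebra_mem 1) _ _ hcomp, ?_⟩
    refine (hH.norm_comp_le _ _ _ _ _ _ _ hmono hsurj _ _
      (hH.mkPiAlgebra_mem 1) _ _ hcomp).trans ?_
    simp only [hH.norm_In, ContinuousLinearMap.norm_toSpanSingleton, mul_one,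
      Fin.prod_univ_one]
    rw [mul_comm]
    gcongr
    exact T.norm_onFullSubtype_le _

end IsPNormedHyperIdeal

/-- In a Banach hyper-ideal, pointwise sums of absolutely summable series belong to the ideal and
satisfy the triangle inequality. -/
lemma IsPBanachHyperIdeal.mem_and_norm_le_tsum (hH : IsPBanachHyperIdeal 𝕜 H Nm 1)
    {a : ℕ → ContinuousMultilinearMap 𝕜 E F} (ha : ∀ j, a j ∈ H n E F)
    (hsum : Summable fun j => Nm n E F (a j)) {A : ContinuousMultilinearMap 𝕜 E F}
    (hA : ∀ x, HasSum (fun j => a j x) (A x)) :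
    A ∈ H n E F ∧ Nm n E F A ≤ ∑' j, Nm n E F (a j) := by
  set u : ℕ → ContinuousMultilinearMap 𝕜 E F := fun k => ∑ j ∈ Finset.range k, a j with hu
  have hu_mem (k : ℕ) : u k ∈ H n E F := hH.sum_mem ha _
  have hdist {k l : ℕ} (hkl : k ≤ l) :
      Nm n E F (u l - u k) ≤ dist (∑ j ∈ Finset.range l, Nm n E F (a j))
        (∑ j ∈ Finset.range k, Nm n E F (a j)) := by
    rw [hu, ← Finset.sum_Ico_eq_sub _ hkl, Real.dist_eq, ← Finset.sum_Ico_eq_sub _ hkl]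
    exact (hH.norm_sum_le ha _).trans (le_abs_self _)
  obtain ⟨B, hB, hBu⟩ := hH.complete n E F u hu_mem fun ε hε => by
    obtain ⟨K, hK⟩ := Metric.cauchySeq_iff.1 hsum.hasSum.tendsto_sum_nat.cauchySeq ε hε
    refine ⟨K, fun k hk l hl => ?_⟩
    rcases le_total l k with h | h
    · exact (hdist h).trans_lt (hK k hk l hl)
    · rw [← neg_sub, hH.norm_neg (hH.sub_mem (hu_mem l) (hu_mem k))]
      exact (hdist h).trans_lt (hK l hl k hk)
  have hAB : A = B := by
    ext x
    have hux : Tendsto (fun k => u k x) atTop (𝓝 (A x)) := by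
      simpa [hu] using (hA x).tendsto_sum_nat
    refine tendsto_nhds_unique hux (tendsto_iff_norm_sub_tendsto_zero.2 ?_)
    refine squeeze_zero (fun _ => norm_nonneg _)
      (fun k => hH.norm_apply_le (hH.sub_mem (hu_mem k) hB) x) ?_
    simpa using hBu.mul_const (∏ i, ‖x i‖)
  subst hAB
  have hlim : Tendsto (fun k => Nm n E F A - Nm n E F (u k - A)) atTop (𝓝 (Nm n E F A)) := by
    simpa using hBu.const_sub (Nm n E F A)
  refine ⟨hB, le_of_tendsto' hlim fun k => ?_⟩
  have htri := hH.norm_add_le n E F (hu_mem k) (hH.neg_mem (hH.sub_mem (hu_mem k) hB))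
  rw [hH.norm_neg (hH.sub_mem (hu_mem k) hB)] at htri
  simp only [Real.rpow_one, neg_sub, add_sub_cancel] at htri
  have := hsum.sum_le_tsum (Finset.range k) fun j _ => hH.norm_nonneg' n E F (a j)
  have := hH.norm_sum_le ha (Finset.range k)
  simp only [hu] at *
  linarith

lemma IsPBanachHyperIdeal.mem_and_norm_le_of_rep (hH : IsPBanachHyperIdeal 𝕜 H Nm 1)
    {A : ContinuousMultilinearMap 𝕜 E F} {lam : ℕ → 𝕜}
    {T : ℕ → ContinuousMultilinearMap 𝕜 E 𝕜} {y : ℕ → F}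
    (hrep : IsHyperNuclearRep 𝕜 1 ⊤ lam T y A) :
    A ∈ H n E F ∧ Nm n E F A ≤ lsNorm 𝕜 1 lam * weakNorm 𝕜 ⊤ T * ⨆ j, ‖y j‖ := by
  obtain ⟨hlam, hT, ⟨c, hc⟩, hA⟩ := hrep
  simp only [MemLs, Real.rpow_one] at hlam
  simp only [WeaklySummable, if_true] at hT
  have hy (j : ℕ) : ‖y j‖ ≤ ⨆ j, ‖y j‖ :=
    le_ciSup (f := fun j => ‖y j‖) ⟨c, Set.forall_mem_range.2 hc⟩ j
  have hw : 0 ≤ weakNorm 𝕜 ⊤ T := (norm_nonneg _).trans (norm_le_weakNorm_top hT 0)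
  have hmem (j : ℕ) : lam j • (T j).smulRight (y j) ∈ H n E F :=
    hH.smul_mem n E F _ (hH.smulRight_mem_and_norm_le (T j) (y j)).1
  have hbound (j : ℕ) : Nm n E F (lam j • (T j).smulRight (y j)) ≤
      ‖lam j‖ * (weakNorm 𝕜 ⊤ T * ⨆ j, ‖y j‖) := by
    obtain ⟨hm, hle⟩ := hH.smulRight_mem_and_norm_le (T j) (y j)
    rw [hH.norm_smul n E F _ hm]
    gcongr
    refine hle.trans ?_
    gcongr
    · exact norm_le_weakNorm_top hT j
    · exact hy j
  have hsum := Summable.of_nonneg_of_le (fun j => hH.norm_nonneg' n E F _) hbound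
    (hlam.mul_right _)
  obtain ⟨hAmem, hle⟩ := hH.mem_and_norm_le_tsum hmem hsum (A := A) fun x => by
    simpa [smul_smul] using hA x
  refine ⟨hAmem, hle.trans ((hsum.tsum_le_tsum hbound (hlam.mul_right _)).trans_eq ?_)⟩
  simp only [lsNorm, Real.rpow_one, div_one]
  rw [tsum_mul_right, mul_assoc]

end Helpers

/-- The hyper-nuclear operators form the smallest Banach hyper-ideal: any Banach
hyper-ideal contains every hyper-nuclear operator, with `‖A‖_H ≤ ‖A‖_HN`. -/
theorem hyperNuclear_smallest_Banach_hyperIdeal (H : MultiClass 𝕜) (Nm : MultiNorm 𝕜)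
    (hH : IsPBanachHyperIdeal 𝕜 H Nm 1) :
    ∀ (n : ℕ) (E : Fin n → Type) [∀ i, NormedAddCommGroup (E i)]
      [∀ i, NormedSpace 𝕜 (E i)] [∀ i, CompleteSpace (E i)]
      (F : Type) [NormedAddCommGroup F] [NormedSpace 𝕜 F] [CompleteSpace F]
      (A : ContinuousMultilinearMap 𝕜 E F), IsHyperNuclear 𝕜 1 ⊤ A →
      A ∈ H n E F ∧ Nm n E F A ≤ hnNorm 𝕜 1 ⊤ A := by
  intro n E _ _ _ F _ _ _ A hA
  obtain ⟨lam, T, y, hrep⟩ := hA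
  refine ⟨(hH.mem_and_norm_le_of_rep hrep).1, le_csInf ⟨_, lam, T, y, hrep, rfl⟩ ?_⟩
  rintro c ⟨lam, T, y, hrep, rfl⟩
  exact (hH.mem_and_norm_le_of_rep hrep).2

end
end

section
/- If I is an operator ideal, then the composition class I∘L is a hyper-ideal. Moreover, if (I,‖·‖_I) is a p-normed (respectively, p-Banach) operator ideal, 0 < p ≤ 1, then (I∘L,‖·‖_{I∘L}) is a p-normed (respectively, p-Banach) hyper-ideal; in particular, if I is a closed operator ideal, then I∘L is a closed hyper-ideal. -/
open Filter Topology
open scoped ENNReal NNReal BigOperators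

noncomputable section

variable (𝕜 : Type) [RCLike 𝕜]

/-- Classes of continuous linear operators between Banach spaces. -/
abbrev OpClass (𝕜' : Type) [RCLike 𝕜'] : Type 1 :=
  ∀ (E : Type) [NormedAddCommGroup E] [NormedSpace 𝕜' E] [CompleteSpace E]
    (F : Type) [NormedAddCommGroup F] [NormedSpace 𝕜' F] [CompleteSpace F],
    Set (E →L[𝕜'] F)

abbrev OpNorm (𝕜' : Type) [RCLike 𝕜'] : Type 1 :=
  ∀ (E : Type) [NormedAddCommGroup E] [NormedSpace 𝕜' E] [CompleteSpace E]
    (F : Type) [NormedAddCommGroup F] [NormedSpace 𝕜' F] [CompleteSpace F],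
    (E →L[𝕜'] F) → ℝ

/-- Operator ideal: each component is a linear subspace containing the finite-rank
operators, stable under left and right composition with continuous linear operators. -/
structure IsOperatorIdeal (I : OpClass 𝕜) : Prop where
  zero_mem : ∀ (E : Type) [NormedAddCommGroup E] [NormedSpace 𝕜 E] [CompleteSpace E]
      (F : Type) [NormedAddCommGroup F] [NormedSpace 𝕜 F] [CompleteSpace F],
      (0 : E →L[𝕜] F) ∈ I E F
  add_mem : ∀ (E : Type) [NormedAddCommGroup E] [NormedSpace 𝕜 E] [CompleteSpace E]
      (F : Type) [NormedAddCommGroup F] [NormedSpace 𝕜 F] [CompleteSpace F]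
      {u v : E →L[𝕜] F}, u ∈ I E F → v ∈ I E F → u + v ∈ I E F
  smul_mem : ∀ (E : Type) [NormedAddCommGroup E] [NormedSpace 𝕜 E] [CompleteSpace E]
      (F : Type) [NormedAddCommGroup F] [NormedSpace 𝕜 F] [CompleteSpace F]
      (c : 𝕜) {u : E →L[𝕜] F}, u ∈ I E F → c • u ∈ I E F
  finiteRank_mem : ∀ (E : Type) [NormedAddCommGroup E] [NormedSpace 𝕜 E] [CompleteSpace E]
      (F : Type) [NormedAddCommGroup F] [NormedSpace 𝕜 F] [CompleteSpace F]
      (u : E →L[𝕜] F), FiniteDimensional 𝕜 (Submodule.span 𝕜 (Set.range (⇑u))) → u ∈ I E F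
  comp_mem : ∀ (E0 E F F0 : Type) [NormedAddCommGroup E0] [NormedSpace 𝕜 E0] [CompleteSpace E0]
      [NormedAddCommGroup E] [NormedSpace 𝕜 E] [CompleteSpace E]
      [NormedAddCommGroup F] [NormedSpace 𝕜 F] [CompleteSpace F]
      [NormedAddCommGroup F0] [NormedSpace 𝕜 F0] [CompleteSpace F0]
      (s : E0 →L[𝕜] E) {u : E →L[𝕜] F} (t : F →L[𝕜] F0),
      u ∈ I E F → (t.comp (u.comp s)) ∈ I E0 F0

/-- `p`-normed operator ideal. -/
structure IsPNormedOperatorIdeal (I : OpClass 𝕜) (N : OpNorm 𝕜) (p : ℝ)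
    extends IsOperatorIdeal 𝕜 I : Prop where
  p_pos : 0 < p
  p_le_one : p ≤ 1
  norm_nonneg' : ∀ (E : Type) [NormedAddCommGroup E] [NormedSpace 𝕜 E] [CompleteSpace E]
      (F : Type) [NormedAddCommGroup F] [NormedSpace 𝕜 F] [CompleteSpace F]
      (u : E →L[𝕜] F), 0 ≤ N E F u
  norm_eq_zero_iff : ∀ (E : Type) [NormedAddCommGroup E] [NormedSpace 𝕜 E] [CompleteSpace E]
      (F : Type) [NormedAddCommGroup F] [NormedSpace 𝕜 F] [CompleteSpace F]
      {u : E →L[𝕜] F}, u ∈ I E F → (N E F u = 0 ↔ u = 0)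
  norm_smul : ∀ (E : Type) [NormedAddCommGroup E] [NormedSpace 𝕜 E] [CompleteSpace E]
      (F : Type) [NormedAddCommGroup F] [NormedSpace 𝕜 F] [CompleteSpace F]
      (c : 𝕜) {u : E →L[𝕜] F}, u ∈ I E F → N E F (c • u) = ‖c‖ * N E F u
  norm_add_le : ∀ (E : Type) [NormedAddCommGroup E] [NormedSpace 𝕜 E] [CompleteSpace E]
      (F : Type) [NormedAddCommGroup F] [NormedSpace 𝕜 F] [CompleteSpace F]
      {u v : E →L[𝕜] F}, u ∈ I E F → v ∈ I E F →
      N E F (u + v) ^ p ≤ N E F u ^ p + N E F v ^ p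
  norm_id : N 𝕜 𝕜 (ContinuousLinearMap.id 𝕜 𝕜) = 1
  norm_comp_le : ∀ (E0 E F F0 : Type) [NormedAddCommGroup E0] [NormedSpace 𝕜 E0] [CompleteSpace E0]
      [NormedAddCommGroup E] [NormedSpace 𝕜 E] [CompleteSpace E]
      [NormedAddCommGroup F] [NormedSpace 𝕜 F] [CompleteSpace F]
      [NormedAddCommGroup F0] [NormedSpace 𝕜 F0] [CompleteSpace F0]
      (s : E0 →L[𝕜] E) {u : E →L[𝕜] F} (t : F →L[𝕜] F0), u ∈ I E F →
      N E0 F0 (t.comp (u.comp s)) ≤ ‖t‖ * N E F u * ‖s‖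

/-- `p`-Banach operator ideal. -/
structure IsPBanachOperatorIdeal (I : OpClass 𝕜) (N : OpNorm 𝕜) (p : ℝ)
    extends IsPNormedOperatorIdeal 𝕜 I N p : Prop where
  complete : ∀ (E : Type) [NormedAddCommGroup E] [NormedSpace 𝕜 E] [CompleteSpace E]
      (F : Type) [NormedAddCommGroup F] [NormedSpace 𝕜 F] [CompleteSpace F]
      (u : ℕ → E →L[𝕜] F), (∀ k, u k ∈ I E F) →
      (∀ ε : ℝ, 0 < ε → ∃ K : ℕ, ∀ k ≥ K, ∀ l ≥ K, N E F (u k - u l) < ε) →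
      ∃ v ∈ I E F, Tendsto (fun k => N E F (u k - v)) atTop (𝓝 0)

/-- A bundled Banach space over `𝕜`. -/
structure BanachSpaceAux (𝕜' : Type) [RCLike 𝕜'] : Type 1 where
  carrier : Type
  [grp : NormedAddCommGroup carrier]
  [mod : NormedSpace 𝕜' carrier]
  [cpl : CompleteSpace carrier]

attribute [instance] BanachSpaceAux.grp BanachSpaceAux.mod BanachSpaceAux.cpl

/-- The composition class `I ∘ L`: operators factoring as `u ∘ B` with `B` a continuous
multilinear operator into some Banach space `G` and `u ∈ I(G;F)`. -/
def compClass (I : OpClass 𝕜) : MultiClass 𝕜 := by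
  intro n E _ _ _ F _ _ _
  exact {A | ∃ (G : BanachSpaceAux 𝕜) (B : ContinuousMultilinearMap 𝕜 E G.carrier)
      (u : G.carrier →L[𝕜] F), u ∈ I G.carrier F ∧ ∀ x, A x = u (B x)}

/-- The norm `‖A‖_{I∘L} = inf ‖u‖_I ‖B‖` over all factorizations `A = u ∘ B`. -/
def compNorm (I : OpClass 𝕜) (N : OpNorm 𝕜) : MultiNorm 𝕜 := by
  intro n E _ _ _ F _ _ _
  exact fun A => sInf {c : ℝ | ∃ (G : BanachSpaceAux 𝕜)
      (B : ContinuousMultilinearMap 𝕜 E G.carrier) (u : G.carrier →L[𝕜] F),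
      u ∈ I G.carrier F ∧ (∀ x, A x = u (B x)) ∧ c = N G.carrier F u * ‖B‖}

section Linearization

open UniformSpace (Completion)
open scoped TensorProduct

variable {𝕜}
variable {n : ℕ} {E : Fin n → Type} [∀ i, NormedAddCommGroup (E i)] [∀ i, NormedSpace 𝕜 (E i)]
  {F : Type} [NormedAddCommGroup F] [NormedSpace 𝕜 F] [CompleteSpace F]

variable (𝕜 E) in
/-- The canonical multilinear map into the completed projective tensor product. -/
def completedTprod : ContinuousMultilinearMap 𝕜 E (Completion (⨂[𝕜] i, E i)) :=
  (Completion.toComplL (𝕜 := 𝕜)).compContinuousMultilinearMap (PiTensorProduct.tprodL 𝕜)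

theorem completedTprod_apply (x : ∀ i, E i) :
    completedTprod 𝕜 E x = ((⨂ₜ[𝕜] i, x i : ⨂[𝕜] i, E i) : Completion (⨂[𝕜] i, E i)) := by
  simp [completedTprod]

theorem norm_completedTprod_apply_le (x : ∀ i, E i) :
    ‖completedTprod 𝕜 E x‖ ≤ ∏ i, ‖x i‖ := by
  rw [completedTprod_apply, Completion.norm_coe]
  exact PiTensorProduct.projectiveSeminorm_tprod_le x

theorem norm_completedTprod_le : ‖completedTprod 𝕜 E‖ ≤ 1 :=
  ContinuousMultilinearMap.opNorm_le_bound zero_le_one fun x => by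
    simpa using norm_completedTprod_apply_le x

/-- The continuous linear operator on the completed projective tensor product associated with
a continuous multilinear operator. -/
def linearization (A : ContinuousMultilinearMap 𝕜 E F) : Completion (⨂[𝕜] i, E i) →L[𝕜] F :=
  (PiTensorProduct.liftIsometry 𝕜 E F A).extend Completion.toComplL

theorem linearization_coe (A : ContinuousMultilinearMap 𝕜 E F) (z : ⨂[𝕜] i, E i) :
    linearization A (z : Completion (⨂[𝕜] i, E i)) = PiTensorProduct.lift A.toMultilinearMap z := by
  rw [← PiTensorProduct.liftIsometry_apply_apply]
  exact ContinuousLinearMap.extend_eq _ (e := Completion.toComplL)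
    Completion.denseRange_coe (Completion.isUniformInducing_coe _) z

@[simp]
theorem linearization_completedTprod (A : ContinuousMultilinearMap 𝕜 E F) (x : ∀ i, E i) :
    linearization A (completedTprod 𝕜 E x) = A x := by
  simp [completedTprod_apply, linearization_coe]

theorem eq_linearization {A : ContinuousMultilinearMap 𝕜 E F}
    {v : Completion (⨂[𝕜] i, E i) →L[𝕜] F} (h : ∀ x, A x = v (completedTprod 𝕜 E x)) :
    v = linearization A := by
  refine (ContinuousLinearMap.extend_unique _ Completion.denseRange_coe
    (Completion.isUniformInducing_coe _) v ?_).symm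
  apply ContinuousLinearMap.coe_injective
  ext x
  simp [h, completedTprod_apply]

theorem norm_linearization_le (A : ContinuousMultilinearMap 𝕜 E F) : ‖linearization A‖ ≤ ‖A‖ := by
  refine ContinuousLinearMap.opNorm_le_bound _ (norm_nonneg _) fun z => ?_
  induction z using Completion.induction_on with
  | hp => exact isClosed_le (by fun_prop) (by fun_prop)
  | ih z =>
    rw [linearization_coe, Completion.norm_coe]
    exact PiTensorProduct.norm_eval_le_projectiveSeminorm A z

@[simp]
theorem linearization_zero : linearization (0 : ContinuousMultilinearMap 𝕜 E F) = 0 :=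
  (eq_linearization fun _ => by simp).symm

@[simp]
theorem linearization_add (A B : ContinuousMultilinearMap 𝕜 E F) :
    linearization (A + B) = linearization A + linearization B :=
  (eq_linearization fun _ => by simp).symm

@[simp]
theorem linearization_sub (A B : ContinuousMultilinearMap 𝕜 E F) :
    linearization (A - B) = linearization A - linearization B :=
  (eq_linearization fun _ => by simp).symm

@[simp]
theorem linearization_smul (c : 𝕜) (A : ContinuousMultilinearMap 𝕜 E F) :
    linearization (c • A) = c • linearization A :=
  (eq_linearization fun _ => by simp).symm

@[simp]
theorem linearization_eq_zero_iff {A : ContinuousMultilinearMap 𝕜 E F} :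
    linearization A = 0 ↔ A = 0 := by
  refine ⟨fun h => ?_, fun h => by simp [h]⟩
  ext x
  simp [← linearization_completedTprod A x, h]

theorem linearization_comp {G : Type} [NormedAddCommGroup G] [NormedSpace 𝕜 G] [CompleteSpace G]
    {A : ContinuousMultilinearMap 𝕜 E F} {B : ContinuousMultilinearMap 𝕜 E G} {u : G →L[𝕜] F}
    (h : ∀ x, A x = u (B x)) : linearization A = u.comp (linearization B) :=
  (eq_linearization fun x => by simp [h]).symm

theorem continuous_linearization :
    Continuous (linearization : ContinuousMultilinearMap 𝕜 E F → _) := by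
  suffices LipschitzWith 1 (linearization : ContinuousMultilinearMap 𝕜 E F → _) from
    this.continuous
  refine LipschitzWith.of_dist_le_mul fun A B => ?_
  rw [dist_eq_norm, dist_eq_norm, ← linearization_sub]
  simpa using norm_linearization_le (A - B)

end Linearization

section BlockComposition

variable {𝕜}
variable {n M : ℕ} {G : Fin M → Type} [∀ j, NormedAddCommGroup (G j)]
  [∀ j, NormedSpace 𝕜 (G j)] {E : Fin n → Type} [∀ i, NormedAddCommGroup (E i)]
  [∀ i, NormedSpace 𝕜 (E i)] {F : Type} [NormedAddCommGroup F] [NormedSpace 𝕜 F]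

theorem exists_blockComp (f : Fin M → Fin n)
    (B : ∀ i : Fin n, ContinuousMultilinearMap 𝕜 (fun j : {j : Fin M // f j = i} => G j.1) (E i))
    (A : ContinuousMultilinearMap 𝕜 E F) :
    ∃ D : ContinuousMultilinearMap 𝕜 G F,
      (∀ x, D x = A fun i => B i fun j => x j.1) ∧ ‖D‖ ≤ ‖A‖ * ∏ i, ‖B i‖ := by
  have update_block (x : ∀ j, G j) (j : Fin M) (v : G j) :
      (fun i => B i fun k => Function.update x j v k.1) =
        Function.update (fun i => B i fun k => x k.1) (f j)
          (B (f j) (Function.update (fun k => x k.1) ⟨j, rfl⟩ v)) := by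
    funext i
    by_cases hi : i = f j
    · subst hi
      rw [Function.update_self]
      congr 1
      funext k
      by_cases hk : k = ⟨j, rfl⟩
      · subst hk
        simp
      · rw [Function.update_of_ne hk, Function.update_of_ne fun h => hk (Subtype.ext h)]
    · rw [Function.update_of_ne hi]
      congr 1
      funext k
      exact Function.update_of_ne (fun h => hi (by rw [← h, k.2])) _ _
  let D : MultilinearMap 𝕜 G F :=
    { toFun := fun x => A fun i => B i fun j => x j.1
      map_update_add' := fun x j v w => by
        obtain rfl := Subsingleton.elim ‹DecidableEq (Fin M)› (instDecidableEqFin M)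
        simp only [update_block, ContinuousMultilinearMap.map_update_add]
      map_update_smul' := fun x j c v => by
        obtain rfl := Subsingleton.elim ‹DecidableEq (Fin M)› (instDecidableEqFin M)
        simp only [update_block, ContinuousMultilinearMap.map_update_smul] }
  have bound (x : ∀ j, G j) : ‖D x‖ ≤ (‖A‖ * ∏ i, ‖B i‖) * ∏ j, ‖x j‖ := by
    calc ‖D x‖ ≤ ‖A‖ * ∏ i, ‖B i fun j => x j.1‖ := A.le_opNorm _
      _ ≤ ‖A‖ * ∏ i, (‖B i‖ * ∏ j : {j : Fin M // f j = i}, ‖x j.1‖) := by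
        gcongr with i
        exact (B i).le_opNorm _
      _ = (‖A‖ * ∏ i, ‖B i‖) * ∏ j, ‖x j‖ := by
        rw [Finset.prod_mul_distrib, Fintype.prod_fiberwise f fun j => ‖x j‖, mul_assoc]
  exact ⟨D.mkContinuous _ bound, fun _ => rfl, D.mkContinuous_norm_le (by positivity) bound⟩

end BlockComposition

section CompClass

open UniformSpace (Completion)
open scoped TensorProduct

variable {𝕜}
variable {n : ℕ} {E : Fin n → Type} [∀ i, NormedAddCommGroup (E i)] [∀ i, NormedSpace 𝕜 (E i)]
  [∀ i, CompleteSpace (E i)] {F : Type} [NormedAddCommGroup F] [NormedSpace 𝕜 F] [CompleteSpace F]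
  {I : OpClass 𝕜} {N : OpNorm 𝕜} {p : ℝ}

theorem mem_compClass_of_factor {G : Type} [NormedAddCommGroup G] [NormedSpace 𝕜 G]
    [CompleteSpace G] {A : ContinuousMultilinearMap 𝕜 E F} (B : ContinuousMultilinearMap 𝕜 E G)
    {u : G →L[𝕜] F} (hu : u ∈ I G F) (h : ∀ x, A x = u (B x)) : A ∈ compClass 𝕜 I n E F :=
  ⟨⟨G⟩, B, u, hu, h⟩

theorem IsOperatorIdeal.comp_right_mem (hI : IsOperatorIdeal 𝕜 I) {E₀ E₁ F₁ : Type}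
    [NormedAddCommGroup E₀] [NormedSpace 𝕜 E₀] [CompleteSpace E₀]
    [NormedAddCommGroup E₁] [NormedSpace 𝕜 E₁] [CompleteSpace E₁]
    [NormedAddCommGroup F₁] [NormedSpace 𝕜 F₁] [CompleteSpace F₁]
    {u : E₁ →L[𝕜] F₁} (hu : u ∈ I E₁ F₁) (s : E₀ →L[𝕜] E₁) : u.comp s ∈ I E₀ F₁ :=
  hI.comp_mem E₀ E₁ F₁ F₁ s (ContinuousLinearMap.id 𝕜 F₁) hu

theorem IsOperatorIdeal.comp_left_mem (hI : IsOperatorIdeal 𝕜 I) {E₁ F₁ F₂ : Type}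
    [NormedAddCommGroup E₁] [NormedSpace 𝕜 E₁] [CompleteSpace E₁]
    [NormedAddCommGroup F₁] [NormedSpace 𝕜 F₁] [CompleteSpace F₁]
    [NormedAddCommGroup F₂] [NormedSpace 𝕜 F₂] [CompleteSpace F₂]
    {u : E₁ →L[𝕜] F₁} (hu : u ∈ I E₁ F₁) (t : F₁ →L[𝕜] F₂) : t.comp u ∈ I E₁ F₂ :=
  hI.comp_mem E₁ E₁ F₁ F₂ (ContinuousLinearMap.id 𝕜 E₁) t hu

theorem IsOperatorIdeal.mem_compClass_iff (hI : IsOperatorIdeal 𝕜 I)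
    {A : ContinuousMultilinearMap 𝕜 E F} :
    A ∈ compClass 𝕜 I n E F ↔ linearization A ∈ I (Completion (⨂[𝕜] i, E i)) F := by
  refine ⟨?_, fun h => mem_compClass_of_factor (completedTprod 𝕜 E) h fun x => by simp⟩
  rintro ⟨G, B, u, hu, h⟩
  rw [linearization_comp h]
  exact hI.comp_right_mem hu _

theorem IsOperatorIdeal.compClass_isHyperIdeal (hI : IsOperatorIdeal 𝕜 I) :
    IsHyperIdeal 𝕜 (compClass 𝕜 I) where
  zero_mem n E _ _ _ F _ _ _ := by
    rw [hI.mem_compClass_iff, linearization_zero]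
    exact hI.zero_mem _ _
  add_mem n E _ _ _ F _ _ _ A B hA hB := by
    rw [hI.mem_compClass_iff] at hA hB ⊢
    rw [linearization_add]
    exact hI.add_mem _ _ hA hB
  smul_mem n E _ _ _ F _ _ _ c A hA := by
    rw [hI.mem_compClass_iff] at hA ⊢
    rw [linearization_smul]
    exact hI.smul_mem _ _ c hA
  comp_mem n M G _ _ _ E _ _ _ F H₀ _ _ _ _ _ _ f _ _ B A hA t C hC := by
    obtain ⟨K, A', u, hu, h⟩ := hA
    obtain ⟨D, hD, -⟩ := exists_blockComp f B A'
    exact mem_compClass_of_factor D (hI.comp_left_mem hu t) fun x => by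
      rw [hC x, h, hD]
      rfl
  finiteType_mem n E _ _ _ F _ _ _ A hA := by
    induction hA using Submodule.span_induction with
    | mem A hA =>
      obtain ⟨φ, y, h⟩ := hA
      refine mem_compClass_of_factor
        ((ContinuousMultilinearMap.mkPiAlgebra 𝕜 (Fin n) 𝕜).compContinuousLinearMap φ)
        (u := ContinuousLinearMap.toSpanSingleton 𝕜 y) (hI.finiteRank_mem _ _ _ ?_)
        fun x => by simp [h]
      have hle : Submodule.span 𝕜 (Set.range (ContinuousLinearMap.toSpanSingleton 𝕜 y)) ≤
          Submodule.span 𝕜 {y} := by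
        rw [Submodule.span_le]
        rintro _ ⟨c, rfl⟩
        exact Submodule.smul_mem _ c (Submodule.mem_span_singleton_self y)
      exact Submodule.finiteDimensional_of_le hle
    | zero =>
      rw [hI.mem_compClass_iff, linearization_zero]
      exact hI.zero_mem _ _
    | add A B _ _ hA hB =>
      rw [hI.mem_compClass_iff] at hA hB ⊢
      rw [linearization_add]
      exact hI.add_mem _ _ hA hB
    | smul c A _ hA =>
      rw [hI.mem_compClass_iff] at hA ⊢
      rw [linearization_smul]
      exact hI.smul_mem _ _ c hA

theorem IsPNormedOperatorIdeal.compNorm_nonneg (hI : IsPNormedOperatorIdeal 𝕜 I N p)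
    (A : ContinuousMultilinearMap 𝕜 E F) : 0 ≤ compNorm 𝕜 I N n E F A := by
  refine Real.sInf_nonneg ?_
  rintro _ ⟨G, B, u, -, -, rfl⟩
  exact mul_nonneg (hI.norm_nonneg' _ _ _) (norm_nonneg _)

theorem IsPNormedOperatorIdeal.compNorm_le (hI : IsPNormedOperatorIdeal 𝕜 I N p) {G : Type}
    [NormedAddCommGroup G] [NormedSpace 𝕜 G] [CompleteSpace G]
    {A : ContinuousMultilinearMap 𝕜 E F} {B : ContinuousMultilinearMap 𝕜 E G}
    {u : G →L[𝕜] F} (hu : u ∈ I G F) (h : ∀ x, A x = u (B x)) :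
    compNorm 𝕜 I N n E F A ≤ N G F u * ‖B‖ := by
  refine csInf_le ⟨0, ?_⟩ ⟨⟨G⟩, B, u, hu, h, rfl⟩
  rintro _ ⟨G, B, u, -, -, rfl⟩
  exact mul_nonneg (hI.norm_nonneg' _ _ _) (norm_nonneg _)

theorem IsPNormedOperatorIdeal.compNorm_eq (hI : IsPNormedOperatorIdeal 𝕜 I N p)
    {A : ContinuousMultilinearMap 𝕜 E F} (hA : A ∈ compClass 𝕜 I n E F) :
    compNorm 𝕜 I N n E F A = N (Completion (⨂[𝕜] i, E i)) F (linearization A) := by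
  apply le_antisymm
  · refine (hI.compNorm_le (B := completedTprod 𝕜 E) (hI.mem_compClass_iff.1 hA)
      fun x => by simp).trans ?_
    exact mul_le_of_le_one_right (hI.norm_nonneg' _ _ _) norm_completedTprod_le
  · obtain ⟨G, B, u, hu, h⟩ := hA
    refine le_csInf ⟨_, G, B, u, hu, h, rfl⟩ ?_
    rintro _ ⟨G, B, u, hu, h, rfl⟩
    have hcomp := hI.norm_comp_le _ _ _ _ (linearization B) (ContinuousLinearMap.id 𝕜 F) hu
    rw [ContinuousLinearMap.id_comp, ← linearization_comp h] at hcomp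
    have hnonneg := hI.norm_nonneg' _ _ u
    calc N _ F (linearization A)
        ≤ ‖ContinuousLinearMap.id 𝕜 F‖ * N G.carrier F u * ‖linearization B‖ := hcomp
      _ ≤ 1 * N G.carrier F u * ‖B‖ := by
        gcongr
        · exact ContinuousLinearMap.norm_id_le
        · exact norm_linearization_le B
      _ = N G.carrier F u * ‖B‖ := by rw [one_mul]

theorem IsPNormedOperatorIdeal.norm_apply_le (hI : IsPNormedOperatorIdeal 𝕜 I N p) {G : Type}
    [NormedAddCommGroup G] [NormedSpace 𝕜 G] [CompleteSpace G] {u : G →L[𝕜] 𝕜}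
    (hu : u ∈ I G 𝕜) (x : G) : ‖u x‖ ≤ N G 𝕜 u * ‖x‖ := by
  have hid : ContinuousLinearMap.id 𝕜 𝕜 ∈ I 𝕜 𝕜 := hI.finiteRank_mem _ _ _ inferInstance
  have hcomp := hI.norm_comp_le _ _ _ _ (ContinuousLinearMap.toSpanSingleton 𝕜 x)
    (ContinuousLinearMap.id 𝕜 𝕜) hu
  have heq : (ContinuousLinearMap.id 𝕜 𝕜).comp
      (u.comp (ContinuousLinearMap.toSpanSingleton 𝕜 x)) =
      u x • ContinuousLinearMap.id 𝕜 𝕜 := by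
    ext
    simp
  rw [heq, hI.norm_smul _ _ _ hid, hI.norm_id] at hcomp
  simpa using hcomp

theorem IsPNormedOperatorIdeal.compNorm_mkPiAlgebra (hI : IsPNormedOperatorIdeal 𝕜 I N p)
    (n : ℕ) :
    compNorm 𝕜 I N n (fun _ => 𝕜) 𝕜 (ContinuousMultilinearMap.mkPiAlgebra 𝕜 (Fin n) 𝕜) = 1 := by
  have hid : ContinuousLinearMap.id 𝕜 𝕜 ∈ I 𝕜 𝕜 := hI.finiteRank_mem _ _ _ inferInstance
  apply le_antisymm
  · simpa [hI.norm_id] using hI.compNorm_le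
      (A := ContinuousMultilinearMap.mkPiAlgebra 𝕜 (Fin n) 𝕜)
      (B := ContinuousMultilinearMap.mkPiAlgebra 𝕜 (Fin n) 𝕜) hid fun _ => rfl
  · refine le_csInf ⟨_, ⟨𝕜⟩, ContinuousMultilinearMap.mkPiAlgebra 𝕜 (Fin n) 𝕜, _, hid,
      fun _ => rfl, rfl⟩ ?_
    rintro _ ⟨G, B, u, hu, h, rfl⟩
    have hone : u (B fun _ => 1) = 1 := by simp [← h]
    have hB : ‖B fun _ => 1‖ ≤ ‖B‖ := by simpa using B.le_opNorm fun _ => 1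
    calc (1 : ℝ) = ‖u (B fun _ => 1)‖ := by simp [hone]
      _ ≤ N G.carrier 𝕜 u * ‖B fun _ => 1‖ := hI.norm_apply_le hu _
      _ ≤ N G.carrier 𝕜 u * ‖B‖ := mul_le_mul_of_nonneg_left hB (hI.norm_nonneg' _ _ _)

theorem IsPNormedOperatorIdeal.compClass_isPNormedHyperIdeal
    (hI : IsPNormedOperatorIdeal 𝕜 I N p) :
    IsPNormedHyperIdeal 𝕜 (compClass 𝕜 I) (compNorm 𝕜 I N) p where
  toIsHyperIdeal := hI.toIsOperatorIdeal.compClass_isHyperIdeal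
  p_pos := hI.p_pos
  p_le_one := hI.p_le_one
  norm_nonneg' n E _ _ _ F _ _ _ A := hI.compNorm_nonneg A
  norm_eq_zero_iff n E _ _ _ F _ _ _ A hA := by
    rw [hI.compNorm_eq hA, hI.norm_eq_zero_iff _ _ (hI.mem_compClass_iff.1 hA),
      linearization_eq_zero_iff]
  norm_smul n E _ _ _ F _ _ _ c A hA := by
    rw [hI.compNorm_eq hA, hI.compNorm_eq (hI.compClass_isHyperIdeal.smul_mem _ _ _ c hA),
      linearization_smul, hI.norm_smul _ _ c (hI.mem_compClass_iff.1 hA)]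
  norm_add_le n E _ _ _ F _ _ _ A B hA hB := by
    rw [hI.compNorm_eq hA, hI.compNorm_eq hB,
      hI.compNorm_eq (hI.compClass_isHyperIdeal.add_mem _ _ _ hA hB), linearization_add]
    exact hI.norm_add_le _ _ (hI.mem_compClass_iff.1 hA) (hI.mem_compClass_iff.1 hB)
  norm_In := hI.compNorm_mkPiAlgebra
  norm_comp_le n M G _ _ _ E _ _ _ F H₀ _ _ _ _ _ _ f _ _ B A hA t C hC := by
    obtain ⟨D, hD, hDnorm⟩ := exists_blockComp f B (completedTprod 𝕜 E)
    have hu := hI.mem_compClass_iff.1 hA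
    have htu := hI.norm_comp_le _ _ _ _ (ContinuousLinearMap.id 𝕜 _) t hu
    rw [ContinuousLinearMap.comp_id] at htu
    have hnonneg := hI.norm_nonneg' _ _ (linearization A)
    rw [hI.compNorm_eq hA]
    calc compNorm 𝕜 I N M G H₀ C
        ≤ N _ H₀ (t.comp (linearization A)) * ‖D‖ :=
          hI.compNorm_le (hI.comp_left_mem hu t) fun x => by simp [hC x, hD]
      _ ≤ (‖t‖ * N _ F (linearization A) * 1) * (1 * ∏ i, ‖B i‖) := by
          gcongr
          · exact htu.trans (by gcongr; exact ContinuousLinearMap.norm_id_le)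
          · exact hDnorm.trans (by gcongr; exact norm_completedTprod_le)
      _ = ‖t‖ * N _ F (linearization A) * ∏ i, ‖B i‖ := by ring

theorem IsPBanachOperatorIdeal.compClass_isPBanachHyperIdeal
    (hI : IsPBanachOperatorIdeal 𝕜 I N p) :
    IsPBanachHyperIdeal 𝕜 (compClass 𝕜 I) (compNorm 𝕜 I N) p where
  toIsPNormedHyperIdeal := hI.toIsPNormedOperatorIdeal.compClass_isPNormedHyperIdeal
  complete n E _ _ _ F _ _ _ A hA hcauchy := by
    have hH := hI.toIsOperatorIdeal.compClass_isHyperIdeal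
    have hsub {B C : ContinuousMultilinearMap 𝕜 E F} (hB : B ∈ compClass 𝕜 I n E F)
        (hC : C ∈ compClass 𝕜 I n E F) : compNorm 𝕜 I N n E F (B - C) =
          N _ F (linearization B - linearization C) := by
      rw [hI.compNorm_eq, linearization_sub]
      rw [sub_eq_add_neg, ← neg_one_smul 𝕜 C]
      exact hH.add_mem _ _ _ hB (hH.smul_mem _ _ _ _ hC)
    obtain ⟨v, hv, hlim⟩ := hI.complete _ _ (fun k => linearization (A k))
      (fun k => hI.mem_compClass_iff.1 (hA k)) fun ε hε => by
        obtain ⟨K, hK⟩ := hcauchy ε hε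
        exact ⟨K, fun k hk l hl => hsub (hA k) (hA l) ▸ hK k hk l hl⟩
    let L := v.compContinuousMultilinearMap (completedTprod 𝕜 E)
    have hL : L ∈ compClass 𝕜 I n E F :=
      mem_compClass_of_factor (completedTprod 𝕜 E) hv fun _ => rfl
    have hvL : v = linearization L := eq_linearization fun _ => rfl
    refine ⟨L, hL, ?_⟩
    simpa only [hsub (hA _) hL, ← hvL] using hlim

theorem IsOperatorIdeal.isClosed_compClass (hI : IsOperatorIdeal 𝕜 I)
    (hclosed : IsClosed (I (Completion (⨂[𝕜] i, E i)) F)) :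
    IsClosed (compClass 𝕜 I n E F) := by
  convert hclosed.preimage (continuous_linearization (E := E) (F := F)) using 1
  ext A
  exact hI.mem_compClass_iff

end CompClass

/-- If `I` is an operator ideal then `I ∘ L` is a hyper-ideal; if `(I, N)` is a
`p`-normed (`p`-Banach) operator ideal then `(I ∘ L, ‖·‖_{I∘L})` is a `p`-normed
(`p`-Banach) hyper-ideal; and if `I` is a closed operator ideal then `I ∘ L` is a
closed hyper-ideal. -/
theorem compClass_isHyperIdeal :
    (∀ I : OpClass 𝕜, IsOperatorIdeal 𝕜 I → IsHyperIdeal 𝕜 (compClass 𝕜 I)) ∧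
    (∀ (I : OpClass 𝕜) (N : OpNorm 𝕜) (p : ℝ), IsPNormedOperatorIdeal 𝕜 I N p →
      IsPNormedHyperIdeal 𝕜 (compClass 𝕜 I) (compNorm 𝕜 I N) p) ∧
    (∀ (I : OpClass 𝕜) (N : OpNorm 𝕜) (p : ℝ), IsPBanachOperatorIdeal 𝕜 I N p →
      IsPBanachHyperIdeal 𝕜 (compClass 𝕜 I) (compNorm 𝕜 I N) p) ∧
    (∀ I : OpClass 𝕜, IsOperatorIdeal 𝕜 I →
      (∀ (E : Type) [NormedAddCommGroup E] [NormedSpace 𝕜 E] [CompleteSpace E]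
        (F : Type) [NormedAddCommGroup F] [NormedSpace 𝕜 F] [CompleteSpace F],
        IsClosed (I E F)) →
      IsHyperIdeal 𝕜 (compClass 𝕜 I) ∧
      ∀ (n : ℕ) (E : Fin n → Type) [∀ i, NormedAddCommGroup (E i)]
      [∀ i, NormedSpace 𝕜 (E i)] [∀ i, CompleteSpace (E i)]
      (F : Type) [NormedAddCommGroup F] [NormedSpace 𝕜 F] [CompleteSpace F],
        IsClosed (compClass 𝕜 I n E F)) := by
  refine ⟨fun I hI => hI.compClass_isHyperIdeal, fun I N p hI => hI.compClass_isPNormedHyperIdeal,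
    fun I N p hI => hI.compClass_isPBanachHyperIdeal, fun I hI hclosed =>
      ⟨hI.compClass_isHyperIdeal, ?_⟩⟩
  intro n E _ _ _ F _ _ _
  exact hI.isClosed_compClass (hclosed _ _)

end
end

section
/- The compact multilinear operators satisfy the hyper-ideal property: let 1 ≤ m1 < ⋯ < mn be naturals, let A ∈ L(E1,…,En;F) be a compact multilinear operator, let B1 ∈ L(G1,…,G_{m1};E1), …, Bn ∈ L(G_{m_{n-1}+1},…,G_{mn};En) be continuous multilinear operators and t ∈ L(F;H0) a continuous linear operator. Then the continuous m_n-linear operator t∘A∘(B1,…,Bn) : (x1,…,x_{mn}) ↦ t(A(B1(x1,…,x_{m1}),…,Bn(x_{m_{n-1}+1},…,x_{mn}))) is a compact multilinear operator. -/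
open Filter Topology
open scoped ENNReal NNReal BigOperators

noncomputable section

variable (𝕜 : Type) [RCLike 𝕜]

/-- A compact multilinear operator: the image of the product of the closed unit balls
is relatively compact in the target space. -/
def IsCompactMultilinear {n : ℕ} {E : Fin n → Type} [∀ i, NormedAddCommGroup (E i)]
    [∀ i, NormedSpace 𝕜 (E i)] {F : Type} [NormedAddCommGroup F] [NormedSpace 𝕜 F]
    (A : ContinuousMultilinearMap 𝕜 E F) : Prop :=
  IsCompact (closure (⇑A '' {x | ∀ i, ‖x i‖ ≤ 1}))

/-- A compact multilinear operator maps every product of balls into a compact set. -/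
theorem IsCompactMultilinear.exists_isCompact_of_norm_le {n : ℕ} {E : Fin n → Type}
    [∀ i, NormedAddCommGroup (E i)] [∀ i, NormedSpace 𝕜 (E i)] {F : Type}
    [NormedAddCommGroup F] [NormedSpace 𝕜 F] {A : ContinuousMultilinearMap 𝕜 E F}
    (hA : IsCompactMultilinear 𝕜 A) {r : Fin n → ℝ} (hr : ∀ i, 0 < r i) :
    ∃ K : Set F, IsCompact K ∧ ∀ x, (∀ i, ‖x i‖ ≤ r i) → A x ∈ K := by
  refine ⟨(fun y => (∏ i, (r i : 𝕜)) • y) '' closure (⇑A '' {x | ∀ i, ‖x i‖ ≤ 1}),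
    IsCompact.image hA (continuous_const_smul _), fun x hx => ?_⟩
  have hr0 : ∀ i, (r i : 𝕜) ≠ 0 := fun i => RCLike.ofReal_ne_zero.2 (hr i).ne'
  refine ⟨A fun i => (r i : 𝕜)⁻¹ • x i, subset_closure ⟨_, fun i => ?_, rfl⟩, ?_⟩
  · rw [norm_smul, norm_inv, RCLike.norm_ofReal, abs_of_pos (hr i), inv_mul_le_one₀ (hr i)]
    exact hx i
  · simp only [← A.map_smul_univ, smul_inv_smul₀ (hr0 _)]

/-- The compact multilinear operators have the hyper-ideal property. -/
theorem compactMultilinear_blockComp {n M : ℕ} {G : Fin M → Type}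
    [∀ j, NormedAddCommGroup (G j)] [∀ j, NormedSpace 𝕜 (G j)] [∀ j, CompleteSpace (G j)]
    {E : Fin n → Type} [∀ i, NormedAddCommGroup (E i)] [∀ i, NormedSpace 𝕜 (E i)]
    [∀ i, CompleteSpace (E i)]
    {F H0 : Type} [NormedAddCommGroup F] [NormedSpace 𝕜 F] [CompleteSpace F]
    [NormedAddCommGroup H0] [NormedSpace 𝕜 H0] [CompleteSpace H0]
    (f : Fin M → Fin n) (hmono : Monotone f) (hsurj : Function.Surjective f)
    (B : ∀ i : Fin n, ContinuousMultilinearMap 𝕜 (fun j : {j : Fin M // f j = i} => G j.1) (E i))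
    (A : ContinuousMultilinearMap 𝕜 E F) (hA : IsCompactMultilinear 𝕜 A)
    (t : F →L[𝕜] H0) (C : ContinuousMultilinearMap 𝕜 G H0)
    (hC : IsBlockComp 𝕜 f B A t C) :
    IsCompactMultilinear 𝕜 C := by
  obtain ⟨K, hK, hAK⟩ := hA.exists_isCompact_of_norm_le 𝕜 (r := fun i => ‖B i‖ + 1)
    fun i => by positivity
  refine (hK.image t.continuous).closure_of_subset ?_
  rintro _ ⟨x, hx, rfl⟩
  refine ⟨_, hAK _ fun i => ?_, (hC x).symm⟩
  calc ‖B i fun j => x j.1‖ ≤ ‖B i‖ * ∏ j : {j : Fin M // f j = i}, ‖x j.1‖ :=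
        (B i).le_opNorm _
    _ ≤ ‖B i‖ * 1 := by
        gcongr
        exact Finset.prod_le_one (fun _ _ => norm_nonneg _) fun j _ => hx j.1
    _ ≤ ‖B i‖ + 1 := by simp

end
end

section
/- Let E1,…,En be Banach spaces and suppose the sequence ((x_j^1,…,x_j^n))_{j=1}^∞ in E1×⋯×En converges multilinearly to (x1,…,xn), i.e., T(x_j^1,…,x_j^n) → T(x1,…,xn) for every continuous n-linear form T ∈ L(E1,…,En). Then there exists K > 0 such that ‖x_j^1‖⋯‖x_j^n‖ ≤ K for every j ∈ ℕ and ‖x1‖⋯‖xn‖ ≤ K. -/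
open Filter Topology
open scoped ENNReal NNReal BigOperators

noncomputable section

variable (𝕜 : Type) [RCLike 𝕜]

/-- `((x_j^1,…,x_j^n))_j` converges multilinearly to `(x₁,…,xₙ)`:
`T(x_j^1,…,x_j^n) → T(x₁,…,xₙ)` for every continuous `n`-linear form `T`. -/
def ConvergesMultilinearly {n : ℕ} {E : Fin n → Type} [∀ i, NormedAddCommGroup (E i)]
    [∀ i, NormedSpace 𝕜 (E i)] (x : ℕ → ∀ i, E i) (xl : ∀ i, E i) : Prop :=
  ∀ T : ContinuousMultilinearMap 𝕜 E 𝕜,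
    Tendsto (fun j => T (x j)) atTop (𝓝 (T xl))

/-- Multilinearly sequentially continuous operators: multilinearly convergent sequences
are mapped to norm convergent sequences. -/
def IsMSC {n : ℕ} {E : Fin n → Type} [∀ i, NormedAddCommGroup (E i)]
    [∀ i, NormedSpace 𝕜 (E i)] {F : Type} [NormedAddCommGroup F] [NormedSpace 𝕜 F]
    (A : ContinuousMultilinearMap 𝕜 E F) : Prop :=
  ∀ (x : ℕ → ∀ i, E i) (xl : ∀ i, E i), ConvergesMultilinearly 𝕜 x xl →
    Tendsto (fun j => A (x j)) atTop (𝓝 (A xl))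

/-- The product of the norms of the coordinates is at most the norm of the evaluation
functional on the space of continuous multilinear forms. -/
theorem prod_norm_le_norm_apply {ι : Type*} [Fintype ι] {E : ι → Type*}
    [∀ i, NormedAddCommGroup (E i)] [∀ i, NormedSpace 𝕜 (E i)] (m : ∀ i, E i) :
    ∏ i, ‖m i‖ ≤ ‖ContinuousMultilinearMap.apply 𝕜 E 𝕜 m‖ := by
  choose g hg hgm using fun i => exists_dual_vector'' 𝕜 (m i)
  set T := (ContinuousMultilinearMap.mkPiAlgebra 𝕜 ι 𝕜).compContinuousLinearMap g with hT
  have hT_norm : ‖T‖ ≤ 1 := by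
    refine ContinuousMultilinearMap.opNorm_le_bound zero_le_one fun v => ?_
    simp only [hT, ContinuousMultilinearMap.compContinuousLinearMap_apply,
      ContinuousMultilinearMap.mkPiAlgebra_apply, norm_prod, one_mul]
    exact Finset.prod_le_prod (fun _ _ => norm_nonneg _) fun i _ =>
      (g i).le_of_opNorm_le (hg i) (v i) |>.trans_eq (one_mul _)
  have hT_apply : ‖ContinuousMultilinearMap.apply 𝕜 E 𝕜 m T‖ = ∏ i, ‖m i‖ := by
    simp [hT, hgm, norm_prod]
  rw [← hT_apply]
  exact ContinuousLinearMap.unit_le_opNorm _ T hT_norm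

/-- A multilinearly convergent sequence is bounded in the sense that the products of the
norms of its coordinates are uniformly bounded. -/
theorem convergesMultilinearly_bounded {n : ℕ} {E : Fin n → Type}
    [∀ i, NormedAddCommGroup (E i)] [∀ i, NormedSpace 𝕜 (E i)] [∀ i, CompleteSpace (E i)]
    (x : ℕ → ∀ i, E i) (xl : ∀ i, E i)
    (hx : ConvergesMultilinearly 𝕜 x xl) :
    ∃ K : ℝ, 0 < K ∧ (∀ j, ∏ i, ‖x j i‖ ≤ K) ∧ ∏ i, ‖xl i‖ ≤ K := by
  obtain ⟨C, hC⟩ := banach_steinhaus (g := fun j => ContinuousMultilinearMap.apply 𝕜 E 𝕜 (x j))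
    fun T => (hx T).norm.bddAbove_range.imp fun _ h j => h ⟨j, rfl⟩
  refine ⟨max 1 (max C (∏ i, ‖xl i‖)), by positivity, fun j => ?_, by simp⟩
  exact (prod_norm_le_norm_apply 𝕜 (x j)).trans ((hC j).trans (by simp))

end
end
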